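/- Let $p_1 \ge \dots \ge p_\sigma \ge 1$ sum to $n$, let $\bar p$ be the conjugate partition, $k = p_1$. Then $j_{S_{\bar p_k} \times \dots \times S_{\bar p_2} \times S_{\bar p_1}}^{W_n}(\mathrm{sgn})$ equals: $[(p_\sigma < p_{\sigma-2}+1 < \dots < p_3+\tau-1 < p_1+\tau), (p_{\sigma-1} < p_{\sigma-3}+1 < \dots < p_2+\tau-1)]$ if $\sigma = 2\tau+1$ is odd, and $[(0 < p_{\sigma-1}+1 < p_{\sigma-3}+2 < \dots < p_3+\tau-1 < p_1+\tau), (p_\sigma < p_{\sigma-2}+1 < \dots < p_2+\tau-1)]$ if $\sigma = 2\tau$ is even. -/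

import Mathlib

open Finset Equiv

namespace CS

noncomputable section

/-- Inner product of class functions on a finite group. -/
def cinner {G : Type} [Group G] (φ ψ : G → ℂ) : ℂ :=
  (Nat.card G : ℂ)⁻¹ * ∑ᶠ g : G, φ g * ψ g⁻¹

/-- The character of the `d`-th symmetric power of a representation with character
`χ`, computed via Newton's recursion
`d·χ_{Sym^d}(g) = ∑_{k=1}^{d} χ(g^k) χ_{Sym^{d-k}}(g)`. -/
def symChar {G : Type} [Group G] (χ : G → ℂ) : ℕ → G → ℂ
  | 0, _ => 1
  | (d+1), g => ((d : ℂ) + 1)⁻¹ *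
      ∑ k ∈ Finset.range (d + 1), χ (g ^ (k + 1)) * symChar χ (d - k) g
  termination_by d _ => d
  decreasing_by omega

/-- Induction of class functions from a subgroup `H` to a subgroup `K` (of an ambient
group `G`), by the usual induced-character formula. -/
def indChar {G : Type} [Group G] (H K : Subgroup G) (φ : H → ℂ) : K → ℂ :=
  open scoped Classical in
  fun g => (Nat.card H : ℂ)⁻¹ *
    ∑ᶠ x : K, if h : ((x : G) * g * (x : G)⁻¹) ∈ H then φ ⟨_, h⟩ else 0

/-- Restriction of a class function on the ambient group to a subgroup. -/
def resChar {G : Type} [Group G] (H : Subgroup G) (χ : G → ℂ) : H → ℂ :=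
  fun h => χ h

/-- Restriction of a class function from a subgroup `K` to a subgroup `H` (junk value
`0` off `K`; meaningful when `H ≤ K`). -/
def resSub {G : Type} [Group G] (H K : Subgroup G) (χ : K → ℂ) : H → ℂ :=
  open scoped Classical in
  fun h => if hh : (h : G) ∈ K then χ ⟨_, hh⟩ else 0

/-- `χ` is the character of a (finite-dimensional, complex) representation. -/
def IsChar {G : Type} [Group G] (χ : G → ℂ) : Prop :=
  ∃ (V : Type) (_ : AddCommGroup V) (_ : Module ℂ V) (ρ : Representation ℂ G V),
    FiniteDimensional ℂ V ∧ ∀ g, χ g = LinearMap.trace ℂ V (ρ g)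

/-- `χ` is an irreducible character: a genuine character of norm one. -/
def IsIrrChar {G : Type} [Group G] (χ : G → ℂ) : Prop :=
  IsChar χ ∧ cinner χ χ = 1

/-- Multiplicity of `χE` in the `d`-th symmetric power of the reflection
representation (with character `χR`). -/
def bMult {G : Type} [Group G] (χR χE : G → ℂ) (d : ℕ) : ℂ :=
  cinner χE (symChar χR d)

/-- `b` is the `b`-invariant of `χE`: the least degree of the symmetric algebra of
the reflection representation containing `χE`. -/
def IsBAt {G : Type} [Group G] (χR χE : G → ℂ) (b : ℕ) : Prop :=
  bMult χR χE b ≠ 0 ∧ ∀ d < b, bMult χR χE d = 0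

/-- `χE = j_H^K (χE')` (GP 5.2.6): `χE` is an irreducible character of `K` occurring
in the induction of `χE'` from `H`, with the same `b`-invariant as `χE'`, where `χE'`
occurs with multiplicity one in the corresponding symmetric power for `H`; the
reflection characters of `H` and `K` are the restrictions of the ambient reflection
character `χR`. -/
def IsJInd {G : Type} [Group G] (χR : G → ℂ) (H K : Subgroup G)
    (χE' : H → ℂ) (χE : K → ℂ) : Prop :=
  IsIrrChar χE ∧ cinner χE (indChar H K χE') ≠ 0 ∧
  ∃ b, IsBAt (resChar H χR) χE' b ∧ bMult (resChar H χR) χE' b = 1 ∧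
    IsBAt (resChar K χR) χE b

/-! ### The hyperoctahedral group and its reflection subgroups.

We realize `W_n` (type `B_n/C_n`) as the permutations of `Fin n ⊕ Fin n`
(thought of as `{1,…,n} ⊔ {-1,…,-n}`) generated by the reflections below; `W'_n`
(type `D_n`) and the various reflection subgroups are likewise generated by the
appropriate reflections. -/

/-- Ambient permutation group of the `2n` points. -/
abbrev PG (n : ℕ) := Equiv.Perm (Fin n ⊕ Fin n)

/-- The reflection-representation matrix of a signed permutation. -/
def Mrefl {n : ℕ} (π : PG n) : Matrix (Fin n) (Fin n) ℂ :=
  Matrix.of fun j i =>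
    (if π (Sum.inl i) = Sum.inl j then 1 else 0) -
      (if π (Sum.inl i) = Sum.inr j then 1 else 0)

/-- The character of the reflection representation (on signed permutations). -/
def reflChar {n : ℕ} : PG n → ℂ := fun π => (Mrefl π).trace

/-- The sign (determinant) character of the reflection representation. -/
def sgnChar {n : ℕ} : PG n → ℂ := fun π => (Mrefl π).det

/-- The reflection `(e_i ↔ e_j)` (a double transposition). -/
def dsw {n : ℕ} (i j : Fin n) : PG n :=
  Equiv.swap (Sum.inl i) (Sum.inl j) * Equiv.swap (Sum.inr i) (Sum.inr j)

/-- The reflection `e_i ↦ -e_i` (a sign change). -/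
def ssw {n : ℕ} (i : Fin n) : PG n := Equiv.swap (Sum.inl i) (Sum.inr i)

/-- The reflection `e_i ↦ -e_j, e_j ↦ -e_i`. -/
def msw {n : ℕ} (i j : Fin n) : PG n :=
  Equiv.swap (Sum.inl i) (Sum.inr j) * Equiv.swap (Sum.inr i) (Sum.inl j)

/-- Types of blocks: symmetric group (`A`-type), hyperoctahedral (`B`-type),
even-signed (`D`-type). -/
inductive BTy | S | B | D
deriving DecidableEq

/-- The reflection subgroup of `W_n` determined by a block structure: `f` assigns to
each index its block, `ty` the type of each index.  On an `S`-block only the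
transpositions `dsw` act, on a `B`-block also the sign changes, on a `D`-block the
`dsw` and the `msw`.  (`W_{m₁} × … `-style products of reflection subgroups.) -/
def blkSub (n : ℕ) (f : Fin n → ℕ) (ty : Fin n → BTy) : Subgroup (PG n) :=
  Subgroup.closure
    ({π | ∃ i j, f i = f j ∧ π = dsw i j} ∪
     {π | ∃ i, ty i = BTy.B ∧ π = ssw i} ∪
     {π | ∃ i j, f i = f j ∧ ty i = BTy.D ∧ ty j = BTy.D ∧ π = msw i j})

/-- The hyperoctahedral group `W_n` (Weyl group of type `B_n/C_n`). -/
def BWn (n : ℕ) : Subgroup (PG n) := blkSub n (fun _ => 0) (fun _ => BTy.B)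

/-- The Weyl group `W'_n` of type `D_n` (the even elements of `W_n`). -/
def DWn (n : ℕ) : Subgroup (PG n) := blkSub n (fun _ => 0) (fun _ => BTy.D)

/-- The block of the index `i`, for blocks of consecutive sizes `c 0, c 1, …`
(`N` blocks in total). -/
def blockOf (N : ℕ) (c : ℕ → ℕ) (i : ℕ) : ℕ :=
  ((Finset.range N).filter fun b => ∑ b' ∈ Finset.range (b + 1), c b' ≤ i).card

/-- The linear character of (a reflection subgroup of) `W_n` given by the product of
the signs of the coordinates in `T`. -/
def epsOn {n : ℕ} (T : Set (Fin n)) : PG n → ℂ :=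
  open scoped Classical in
  fun π => ∏ᶠ i : Fin n, if i ∈ T ∧ (∃ j, π (Sum.inl i) = Sum.inr j) then -1 else 1

/-- The basic induced character of `W_n` attached to two sequences of (possibly
negative, in which case the character is `0`) block sizes: the character induced from
the product of the hyperoctahedral groups of the blocks, of the (trivial) ⊠ (product
of signs of coordinates) character, the second family of blocks carrying the
sign-of-coordinates character.  (These are the `h`-pieces of the Jacobi–Trudi-type
formula for the irreducible characters of `W_n`.) -/
def indPiece (n r s : ℕ) (c : Fin r → ℤ) (d : Fin s → ℤ) : (BWn n) → ℂ :=
  open scoped Classical in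
  if (∀ i, 0 ≤ c i) ∧ (∀ j, 0 ≤ d j) ∧ ((∑ i, c i) + ∑ j, d j) = (n : ℤ) then
    letI cs : ℕ → ℕ := fun b =>
      if hb : b < r then (c ⟨b, hb⟩).toNat
      else if hb' : b - r < s then (d ⟨b - r, hb'⟩).toNat else 0
    letI f : Fin n → ℕ := fun i => blockOf (r + s) cs (i : ℕ)
    indChar (blkSub n f (fun _ => BTy.B)) (BWn n)
      (resChar _ (epsOn {i | r ≤ f i}))
  else 0

/-- The irreducible character of the hyperoctahedral group `W_n` attached to a
bipartition `(α, β)` (each written as a weakly decreasing integer vector), via the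
Jacobi–Trudi-type determinantal formula
`χ_{(α,β)} = ∑_{σ,τ} sgn(σ)sgn(τ) · indPiece((αᵢ - i + σ(i))ᵢ, (βⱼ - j + τ(j))ⱼ)`. -/
def chiB (n r s : ℕ) (α : Fin r → ℤ) (β : Fin s → ℤ) : (BWn n) → ℂ :=
  fun w => ∑ᶠ σ : Equiv.Perm (Fin r), ∑ᶠ τ : Equiv.Perm (Fin s),
    (((Equiv.Perm.sign σ : ℤ) * (Equiv.Perm.sign τ : ℤ) : ℤ) : ℂ) *
      indPiece n r s (fun i => α i - (i : ℕ) + ((σ i : ℕ) : ℤ))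
        (fun j => β j - (j : ℕ) + ((τ j : ℕ) : ℤ)) w

/-- The irreducible character of `W_n` attached to a symbol
`[(λ₀ < … < λ_m), (μ₀ < … < μ_{m-1})]` (rows written as increasing sequences, with
`∑λ + ∑μ = m² + n`): subtract the staircases to get the bipartition. -/
def chiBSymbol (n m : ℕ) (row1 : Fin (m + 1) → ℕ) (row2 : Fin m → ℕ) : (BWn n) → ℂ :=
  chiB n (m + 1) m
    (fun i => (row1 ⟨m - (i : ℕ), by have := i.isLt; omega⟩ : ℤ) - ((m - (i : ℕ) : ℕ) : ℤ))
    (fun j => (row2 ⟨m - 1 - (j : ℕ), by have := j.isLt; omega⟩ : ℤ) -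
      ((m - 1 - (j : ℕ) : ℕ) : ℤ))

/-- The irreducible character of `W'_n` (type `D_n`) attached to a symbol
`[(λ₀ < … < λ_{m-1}), (μ₀ < … < μ_{m-1})]` with distinct rows (`∑λ + ∑μ = m² - m + n`):
the restriction to `W'_n` of the corresponding character of `W_n`. -/
def chiDSymbol (n m : ℕ) (row1 row2 : Fin m → ℕ) : (DWn n) → ℂ :=
  resSub (DWn n) (BWn n)
    (chiB n m m
      (fun i => (row1 ⟨m - 1 - (i : ℕ), by have := i.isLt; omega⟩ : ℤ) -
        ((m - 1 - (i : ℕ) : ℕ) : ℤ))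
      (fun j => (row2 ⟨m - 1 - (j : ℕ), by have := j.isLt; omega⟩ : ℤ) -
        ((m - 1 - (j : ℕ) : ℕ) : ℤ)))

/-- The Cauchy determinant `det (1 / (1 - xᵢ yⱼ))` over a commutative ring. -/
lemma det_cauchy {R : Type*} [CommRing R] : ∀ (r : ℕ) (x y : Fin r → R) (g : Fin r → Fin r → R),
    (∀ i j, (1 - x i * y j) * g i j = 1) →
    (Matrix.of g).det = (Matrix.vandermonde x).det * (Matrix.vandermonde y).det *
      ∏ i, ∏ j, g i j
  | 0, _, _, _, _ => by simp
  | r + 1, x, y, g, hg => by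
    have ih := det_cauchy r (fun i => x i.succ) (fun j => y j.succ)
      (fun i j => g i.succ j.succ) (fun i j => hg _ _)
    have hrow : ∀ i j, g i j - g 0 j = (x i - x 0) * (y j * g i j) * g 0 j := fun i j => by
      linear_combination (g 0 j) * hg i j - g i j * hg 0 j
    have hcol : ∀ i j, y j * g i j - y 0 * g i 0 = (y j - y 0) * g i j * g i 0 := fun i j => by
      linear_combination (y 0 * g i 0) * hg i j - y j * g i j * hg i 0
    let A : Matrix (Fin (r + 1)) (Fin (r + 1)) R :=
      Matrix.of fun i j => Fin.cases 1 (fun i' => y j * g i'.succ j) i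
    let s : Fin (r + 1) → R := Fin.cases 1 (fun i => x i.succ - x 0)
    have h1 : (Matrix.of g).det = (Matrix.of fun i j => s i * (A i j * g 0 j)).det := by
      refine Matrix.det_eq_of_forall_row_eq_smul_add_const (Fin.cases 0 fun _ => 1) 0 rfl ?_
      intro i j
      refine Fin.cases ?_ (fun i => ?_) i
      · simp [s, A]
      · simp only [s, A, Matrix.of_apply, Fin.cases_succ, Fin.cases_zero]
        linear_combination hrow i.succ j
    have h2 : (Matrix.of fun i j => s i * (A i j * g 0 j)).det =
        (∏ i, s i) * ((∏ j, g 0 j) * A.det) := by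
      rw [← Matrix.det_mul_row, ← Matrix.det_mul_column]
      congr 1
      ext i j
      simp only [Matrix.of_apply]
      ring
    let t : Fin (r + 1) → R := Fin.cases 1 (fun j => y j.succ - y 0)
    let u : Fin (r + 1) → R := Fin.cases 1 (fun i => g i.succ 0)
    let C : Matrix (Fin (r + 1)) (Fin (r + 1)) R :=
      Matrix.of fun i j => Fin.cases (A i 0) (fun j' => A i j'.succ - A i 0) j
    have h3 : A.det = C.det := by
      rw [← Matrix.det_transpose A, ← Matrix.det_transpose C]
      refine Matrix.det_eq_of_forall_row_eq_smul_add_const (Fin.cases 0 fun _ => 1) 0 rfl ?_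
      intro j i
      refine Fin.cases ?_ (fun j => ?_) j <;> simp [C]
    have h4 : C.det = (∏ i : Fin r, (y i.succ - y 0)) * ((∏ i : Fin r, g i.succ 0) *
        (Matrix.of fun i j : Fin r => g i.succ j.succ).det) := by
      rw [Matrix.det_succ_row_zero, Fin.sum_univ_succ]
      have : ∀ j : Fin r, C 0 j.succ = 0 := fun j => by simp [C, A]
      simp only [this]
      rw [← Matrix.det_mul_column, ← Matrix.det_mul_row]
      simp only [Fin.val_zero, pow_zero, one_mul, mul_zero, zero_mul, sum_const_zero, add_zero]
      have h0 : C 0 0 = 1 := by simp [C, A]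
      rw [h0, one_mul]
      congr 1
      ext i j
      simp only [C, A, Matrix.of_apply, Matrix.submatrix_apply, Fin.succAbove_zero, Fin.cases_succ]
      linear_combination hcol i.succ j.succ
    rw [h1, h2, h3, h4, ih]
    simp only [Matrix.det_vandermonde, s]
    simp only [Fin.prod_univ_succ, Fin.cases_zero, Fin.cases_succ, Fin.prod_Ioi_zero,
      Fin.prod_Ioi_succ, prod_mul_distrib]
    ring

/-- The signed indicator that the vector `c` is obtained from `l` by subtracting a
permutation of the staircase. -/
def stair {r : ℕ} (l c : Fin r → ℕ) : ℤ :=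
  ∑ σ : Perm (Fin r), (Perm.sign σ : ℤ) * if (fun i => c i + (σ i).rev) = l then 1 else 0

lemma coeff_monomials {r : ℕ} (u v l : Fin r → ℕ) :
    MvPolynomial.coeff (Finsupp.equivFunOnFinite.symm (Sum.elim l l))
      ((∏ i, (MvPolynomial.X (Sum.inl i) : MvPolynomial (Fin r ⊕ Fin r) ℤ) ^ u i) *
        ∏ i, MvPolynomial.X (Sum.inr i) ^ v i) =
    (if u = l then 1 else 0) * (if v = l then 1 else 0) := by
  have : ((∏ i, (MvPolynomial.X (Sum.inl i) : MvPolynomial (Fin r ⊕ Fin r) ℤ) ^ u i) *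
        ∏ i, MvPolynomial.X (Sum.inr i) ^ v i) =
      MvPolynomial.monomial (Finsupp.equivFunOnFinite.symm (Sum.elim u v)) 1 := by
    rw [MvPolynomial.monomial_eq, Finsupp.prod_fintype _ _ (by simp)]
    simp
  rw [this, MvPolynomial.coeff_monomial]
  simp only [EmbeddingLike.apply_eq_iff_eq, Sum.elim_eq_iff, ite_and, ite_mul, one_mul, zero_mul]

lemma det_vandermonde_rev {R : Type*} [CommRing R] {r : ℕ} (x : Fin r → R) :
    ∑ σ : Perm (Fin r), ((Perm.sign σ : ℤ) : R) * ∏ i, x i ^ ((σ i).rev : ℕ) =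
      ((Perm.sign (Fin.revPerm (n := r)) : ℤ) : R) * (Matrix.vandermonde x).det := by
  rw [← Matrix.det_permute', ← Matrix.det_transpose, Matrix.det_apply']
  rfl

/-- Pairing two copies of the Jacobi–Trudi expansion: the norm of a Schur function is one. -/
lemma sum_stair_mul_stair {r B : ℕ} (l : Fin r → ℕ) (hl : Function.Injective l)
    (hB : ∀ i, l i < B) :
    ∑ N : Fin r × Fin r → Fin B, stair l (fun i => ∑ j, (N (i, j) : ℕ)) *
      stair l (fun j => ∑ i, (N (i, j) : ℕ)) = 1 := by
  classical
  let P := MvPolynomial (Fin r ⊕ Fin r) ℤ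
  let X : Fin r → P := fun i => MvPolynomial.X (Sum.inl i)
  let Y : Fin r → P := fun i => MvPolynomial.X (Sum.inr i)
  let G : Fin r → Fin r → P := fun i j => ∑ k : Fin B, (X i * Y j) ^ (k : ℕ)
  let a : (Fin r → P) → P := fun x =>
    ∑ σ : Perm (Fin r), ((Perm.sign σ : ℤ) : P) * ∏ i, x i ^ ((σ i).rev : ℕ)
  let I : Ideal P := Ideal.span
    ((fun s => MvPolynomial.monomial s (1 : ℤ)) '' Set.range (fun i => Finsupp.single (Sum.inl i) B))
  let m : (Fin r ⊕ Fin r) →₀ ℕ := Finsupp.equivFunOnFinite.symm (Sum.elim l l)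
  have hX : ∀ i, X i ^ B ∈ I := fun i => by
    refine Ideal.subset_span ⟨_, ⟨i, rfl⟩, ?_⟩
    exact (MvPolynomial.X_pow_eq_monomial ..).symm
  have key : (Matrix.of G).det - a X * a Y * ∏ i, ∏ j, G i j ∈ I := by
    rw [← Ideal.Quotient.eq]
    have h := det_cauchy r (fun i => Ideal.Quotient.mk I (X i)) (fun i => Ideal.Quotient.mk I (Y i))
      (fun i j => Ideal.Quotient.mk I (G i j)) (fun i j => by
        rw [← map_mul, ← map_one (Ideal.Quotient.mk I), ← map_sub, ← map_mul, Ideal.Quotient.eq]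
        have : (1 - X i * Y j) * G i j = 1 - (X i * Y j) ^ B := by
          simp only [G]
          rw [Fin.sum_univ_eq_sum_range (fun k => (X i * Y j) ^ k), mul_neg_geom_sum]
        rw [this, sub_sub_cancel_left, mul_pow]
        exact I.neg_mem (I.mul_mem_right _ (hX i)))
    have h2 : ∀ x : Fin r → P, Ideal.Quotient.mk I (a x) =
        ((Perm.sign (Fin.revPerm (n := r)) : ℤ) : P ⧸ I) *
          (Matrix.vandermonde fun i => Ideal.Quotient.mk I (x i)).det := fun x => by
      rw [← det_vandermonde_rev]
      simp [a]
    rw [map_mul, map_mul, h2, h2, RingHom.map_det]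
    have h3 : ((Perm.sign (Fin.revPerm (n := r)) : ℤ) : P ⧸ I) *
        ((Perm.sign (Fin.revPerm (n := r)) : ℤ) : P ⧸ I) = 1 := by
      rw [← Int.cast_mul, ← Units.val_mul, Int.units_mul_self]; simp
    simp only [map_prod]
    refine Eq.trans h ?_
    linear_combination (-(Matrix.vandermonde fun i => Ideal.Quotient.mk I (X i)).det *
      (Matrix.vandermonde fun i => Ideal.Quotient.mk I (Y i)).det *
        ∏ i, ∏ j, Ideal.Quotient.mk I (G i j)) * h3
  have hcoef : MvPolynomial.coeff m (Matrix.of G).det =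
      MvPolynomial.coeff m (a X * a Y * ∏ i, ∏ j, G i j) := by
    rw [← sub_eq_zero, ← MvPolynomial.coeff_sub]
    by_contra hne
    obtain ⟨s, ⟨i, rfl⟩, hs⟩ := MvPolynomial.mem_ideal_span_monomial_image.1 key m
      (MvPolynomial.mem_support_iff.2 hne)
    have := hs (Sum.inl i)
    simp [m] at this
    exact absurd (hB i) (not_lt.2 this)
  have hsmul : ∀ (z : ℤ) (q : P), MvPolynomial.coeff m ((z : P) * q) =
      z * MvPolynomial.coeff m q := fun z q => by
    rw [← zsmul_eq_mul, MvPolynomial.coeff_smul, smul_eq_mul]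
  have hleft : MvPolynomial.coeff m (Matrix.of G).det = 1 := by
    have hexp : ∀ σ : Perm (Fin r), MvPolynomial.coeff m
        (((Perm.sign σ : ℤ) : P) * ∏ i, Matrix.of G (σ i) i) =
        (Perm.sign σ : ℤ) * if l ∘ σ = l then 1 else 0 := fun σ => by
      rw [hsmul]
      congr 1
      simp only [Matrix.of_apply, G]
      rw [Finset.prod_univ_sum, MvPolynomial.coeff_sum, Fintype.piFinset_univ]
      have : ∀ k : Fin r → Fin B, MvPolynomial.coeff m (∏ i, (X (σ i) * Y i) ^ (k i : ℕ)) =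
          if k = fun i => ⟨l i, hB i⟩ then (if l ∘ σ = l then 1 else 0) else 0 := fun k => by
        have hk : ∏ i, (X (σ i) * Y i) ^ (k i : ℕ) =
            (∏ i, X i ^ (k (σ⁻¹ i) : ℕ)) * ∏ i, Y i ^ (k i : ℕ) := by
          rw [← Equiv.prod_comp σ (fun i => X i ^ (k (σ⁻¹ i) : ℕ))]
          simp [mul_pow, prod_mul_distrib]
        rw [hk]
        refine (coeff_monomials _ _ _).trans ?_
        have e1 : (fun i => (k i : ℕ)) = l ↔ k = fun i => ⟨l i, hB i⟩ := by
          simp [funext_iff, Fin.ext_iff]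
        have e2 : (fun i => l (σ⁻¹ i)) = l ↔ l ∘ σ = l := by
          constructor <;> intro h <;> funext i
          · simpa using (congrFun h (σ i)).symm
          · simpa using (congrFun h (σ⁻¹ i)).symm
        simp only [e1]
        split_ifs with h1 h2 h3 h4 h5 <;> simp_all
      simp only [this]
      simp
    rw [Matrix.det_apply', MvPolynomial.coeff_sum, Finset.sum_congr rfl fun σ _ => hexp σ,
      Finset.sum_eq_single 1]
    · simp
    · intro σ _ hσ
      rw [if_neg, mul_zero]
      intro h
      exact hσ (Equiv.ext fun i => hl (congrFun h i))
    · simp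
  have hprod : ∏ i, ∏ j, G i j = ∑ N : Fin r × Fin r → Fin B,
      (∏ i, X i ^ (∑ j, (N (i, j) : ℕ))) * ∏ j, Y j ^ (∑ i, (N (i, j) : ℕ)) := by
    rw [← Fintype.prod_prod_type' G]
    simp only [G]
    rw [Finset.prod_univ_sum, Fintype.piFinset_univ]
    refine Finset.sum_congr rfl fun N _ => ?_
    simp only [mul_pow, prod_mul_distrib, ← prod_pow_eq_pow_sum]
    rw [Fintype.prod_prod_type, Fintype.prod_prod_type_right]
  rw [← hleft, hcoef, hprod, Finset.mul_sum, MvPolynomial.coeff_sum]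
  refine Finset.sum_congr rfl fun N _ => ?_
  simp only [stair, a]
  rw [Finset.sum_mul_sum, Finset.sum_mul_sum, Finset.sum_mul, MvPolynomial.coeff_sum]
  refine Finset.sum_congr rfl fun σ _ => ?_
  rw [Finset.sum_mul, MvPolynomial.coeff_sum]
  refine Finset.sum_congr rfl fun σ' _ => ?_
  have : ∀ (z z' : P) (f f' g g' : Fin r → P),
      z * (∏ i, f i) * (z' * ∏ i, f' i) * ((∏ i, g i) * ∏ i, g' i) =
      z * (z' * ((∏ i, g i * f i) * ∏ i, g' i * f' i)) := fun _ _ _ _ _ _ => by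
    simp only [prod_mul_distrib]; ring
  rw [this, hsmul, hsmul]
  simp only [← pow_add]
  rw [coeff_monomials]
  ring

/-- The signed permutation `e_i ↦ ± e_{u i}`, with a minus sign where `s i` holds. -/
def signedPerm {n : ℕ} (u : Perm (Fin n)) (s : Fin n → Bool) : PG n where
  toFun := Sum.elim (fun i => bif s i then Sum.inr (u i) else Sum.inl (u i))
    (fun i => bif s i then Sum.inl (u i) else Sum.inr (u i))
  invFun := Sum.elim (fun i => bif s (u⁻¹ i) then Sum.inr (u⁻¹ i) else Sum.inl (u⁻¹ i))
    (fun i => bif s (u⁻¹ i) then Sum.inl (u⁻¹ i) else Sum.inr (u⁻¹ i))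
  left_inv x := by
    rcases x with i | i <;> cases h : s i <;> simp [h]
  right_inv x := by
    rcases x with i | i <;> cases h : s (u⁻¹ i) <;> simp_all

@[simp] lemma signedPerm_inl {n : ℕ} (u : Perm (Fin n)) (s : Fin n → Bool) (i : Fin n) :
    signedPerm u s (Sum.inl i) = bif s i then Sum.inr (u i) else Sum.inl (u i) := rfl

@[simp] lemma signedPerm_inr {n : ℕ} (u : Perm (Fin n)) (s : Fin n → Bool) (i : Fin n) :
    signedPerm u s (Sum.inr i) = bif s i then Sum.inl (u i) else Sum.inr (u i) := rfl

lemma signedPerm_mul {n : ℕ} (u v : Perm (Fin n)) (s t : Fin n → Bool) :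
    signedPerm u s * signedPerm v t = signedPerm (u * v) (fun i => xor (s (v i)) (t i)) := by
  ext x
  rcases x with i | i <;> cases h : t i <;> cases h' : s (v i) <;> simp [h, h']

lemma signedPerm_one {n : ℕ} : signedPerm (1 : Perm (Fin n)) (fun _ => false) = 1 := by
  ext x
  rcases x with i | i <;> simp

lemma signedPerm_inv {n : ℕ} (u : Perm (Fin n)) (s : Fin n → Bool) :
    (signedPerm u s)⁻¹ = signedPerm u⁻¹ (fun i => s (u⁻¹ i)) := by
  rw [inv_eq_iff_mul_eq_one, signedPerm_mul]
  simp [← signedPerm_one]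

lemma signedPerm_injective {n : ℕ} {u v : Perm (Fin n)} {s t : Fin n → Bool}
    (h : signedPerm u s = signedPerm v t) : u = v ∧ s = t := by
  have key : ∀ i, u i = v i ∧ s i = t i := fun i => by
    have := congrArg (fun π : PG n => π (Sum.inl i)) h
    revert this
    cases h1 : s i <;> cases h2 : t i <;> simp [h1, h2]
  exact ⟨Equiv.ext fun i => (key i).1, funext fun i => (key i).2⟩

lemma dsw_eq {n : ℕ} (i j : Fin n) : dsw i j = signedPerm (swap i j) (fun _ => false) := by
  ext x
  rcases x with k | k
  · simp only [dsw, Perm.mul_apply, swap_apply_def, signedPerm_inl, reduceCtorEq, if_false,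
      Sum.inl.injEq, cond_false]
    split_ifs <;> simp_all
  · simp only [dsw, Perm.mul_apply, swap_apply_def, signedPerm_inr, Sum.inr.injEq, cond_false]
    split_ifs <;> simp_all

lemma ssw_eq {n : ℕ} (i : Fin n) : ssw i = signedPerm 1 (fun j => decide (j = i)) := by
  ext x
  rcases x with k | k
  · by_cases h : k = i <;> simp [ssw, swap_apply_def, h]
  · by_cases h : k = i <;> simp [ssw, swap_apply_def, h]

lemma mem_closure_swap {n : ℕ} (f : Fin n → ℕ) (u : Perm (Fin n)) (hu : ∀ i, f (u i) = f i) :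
    u ∈ Subgroup.closure {v : Perm (Fin n) | ∃ i j, f i = f j ∧ i ≠ j ∧ v = swap i j} := by
  rw [_root_.mem_closure_isSwap (by rintro _ ⟨i, j, -, hij, rfl⟩; exact ⟨i, j, hij, rfl⟩)]
  refine ⟨Set.toFinite _, fun x => ?_⟩
  by_cases hx : u x = x
  · rw [hx]; exact MulAction.mem_orbit_self _
  · exact ⟨⟨swap x (u x), Subgroup.subset_closure ⟨x, u x, (hu x).symm, Ne.symm hx, rfl⟩⟩,
      swap_apply_left _ _⟩

lemma signedPerm_false_mem {n : ℕ} (f : Fin n → ℕ) (ty : Fin n → BTy) (u : Perm (Fin n))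
    (hu : ∀ i, f (u i) = f i) : signedPerm u (fun _ => false) ∈ blkSub n f ty := by
  have h := mem_closure_swap f u hu
  clear hu
  induction h using Subgroup.closure_induction with
  | mem v hv =>
    obtain ⟨i, j, hij, -, rfl⟩ := hv
    exact Subgroup.subset_closure (Or.inl (Or.inl ⟨i, j, hij, (dsw_eq i j).symm⟩))
  | one => rw [signedPerm_one]; exact one_mem _
  | mul a b _ _ ha hb => simpa [signedPerm_mul] using mul_mem ha hb
  | inv a _ ha => simpa [signedPerm_inv] using inv_mem ha

lemma apply_swap_eq {n : ℕ} {α : Type*} (f : Fin n → α) {i j : Fin n} (h : f i = f j)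
    (k : Fin n) : f (swap i j k) = f k := by
  rw [swap_apply_def]; split_ifs <;> simp_all

lemma apply_inv_eq {n : ℕ} {α : Type*} {f : Fin n → α} {u : Perm (Fin n)}
    (h : ∀ i, f (u i) = f i) (i : Fin n) : f (u⁻¹ i) = f i := by
  simpa using (h (u⁻¹ i)).symm

/-- A product of symmetric groups consists of the permutations preserving the blocks. -/
lemma mem_blkSub_S {n : ℕ} (f : Fin n → ℕ) (π : PG n) :
    π ∈ blkSub n f (fun _ => BTy.S) ↔
      ∃ u : Perm (Fin n), (∀ i, f (u i) = f i) ∧ π = signedPerm u (fun _ => false) := by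
  constructor
  · intro h
    induction h using Subgroup.closure_induction with
    | mem v hv =>
      obtain (⟨i, j, hij, rfl⟩ | ⟨i, hi, -⟩) | ⟨i, j, -, hi, -⟩ := hv
      · exact ⟨swap i j, apply_swap_eq f hij, dsw_eq i j⟩
      · cases hi
      · cases hi
    | one => exact ⟨1, by simp, signedPerm_one.symm⟩
    | mul a b _ _ ha hb =>
      obtain ⟨u, hu, rfl⟩ := ha
      obtain ⟨v, hv, rfl⟩ := hb
      exact ⟨u * v, fun i => by simp [hu, hv], by simp [signedPerm_mul]⟩
    | inv a _ ha =>
      obtain ⟨u, hu, rfl⟩ := ha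
      exact ⟨u⁻¹, apply_inv_eq hu, by simp [signedPerm_inv]⟩
  · rintro ⟨u, hu, rfl⟩
    exact signedPerm_false_mem f _ u hu

/-- A product of hyperoctahedral groups consists of the signed permutations preserving the
blocks. -/
lemma mem_blkSub_B {n : ℕ} (f : Fin n → ℕ) (π : PG n) :
    π ∈ blkSub n f (fun _ => BTy.B) ↔
      ∃ u s, (∀ i, f (u i) = f i) ∧ π = signedPerm u s := by
  constructor
  · intro h
    induction h using Subgroup.closure_induction with
    | mem v hv =>
      obtain (⟨i, j, hij, rfl⟩ | ⟨i, -, rfl⟩) | ⟨i, j, -, hi, -⟩ := hv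
      · exact ⟨swap i j, _, apply_swap_eq f hij, dsw_eq i j⟩
      · exact ⟨1, _, by simp, ssw_eq i⟩
      · cases hi
    | one => exact ⟨1, _, by simp, signedPerm_one.symm⟩
    | mul a b _ _ ha hb =>
      obtain ⟨u, s, hu, rfl⟩ := ha
      obtain ⟨v, t, hv, rfl⟩ := hb
      exact ⟨u * v, _, fun i => by simp [hu, hv], signedPerm_mul ..⟩
    | inv a _ ha =>
      obtain ⟨u, s, hu, rfl⟩ := ha
      exact ⟨u⁻¹, _, apply_inv_eq hu, signedPerm_inv ..⟩
  · rintro ⟨u, s, hu, rfl⟩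
    have h1 : ∀ t : Finset (Fin n), signedPerm 1 (fun i => decide (i ∈ t)) ∈
        blkSub n f (fun _ => BTy.B) := fun t => by
      induction t using Finset.induction_on with
      | empty => simp [signedPerm_one, one_mem]
      | insert a t hat ih =>
        have hs : ssw a ∈ blkSub n f (fun _ => BTy.B) :=
          Subgroup.subset_closure (Or.inl (Or.inr ⟨a, rfl, rfl⟩))
        have h2 := mul_mem hs ih
        rw [ssw_eq, signedPerm_mul, mul_one] at h2
        convert h2 using 2
        funext i
        by_cases h : i = a
        · subst h; simp [hat]
        · simp [h]
    have h3 := mul_mem (signedPerm_false_mem f (fun _ => BTy.B) u hu)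
      (h1 (Finset.univ.filter fun i => s i = true))
    rw [signedPerm_mul] at h3
    simpa using h3

lemma mem_BWn {n : ℕ} (π : PG n) : π ∈ BWn n ↔ ∃ u s, π = signedPerm u s := by
  simp [BWn, mem_blkSub_B]

/-- The hyperoctahedral group as a set of pairs of a permutation and a vector of signs. -/
def eqvBWn (n : ℕ) : Perm (Fin n) × (Fin n → Bool) ≃ BWn n :=
  Equiv.ofBijective (fun x => ⟨signedPerm x.1 x.2, (mem_BWn _).2 ⟨_, _, rfl⟩⟩)
    ⟨fun _ _ h => Prod.ext (signedPerm_injective (congrArg Subtype.val h)).1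
      (signedPerm_injective (congrArg Subtype.val h)).2,
    fun w => by
      obtain ⟨u, s, h⟩ := (mem_BWn _).1 w.2
      exact ⟨(u, s), Subtype.ext h.symm⟩⟩

@[simp] lemma coe_eqvBWn {n : ℕ} (x : Perm (Fin n) × (Fin n → Bool)) :
    (eqvBWn n x : PG n) = signedPerm x.1 x.2 := rfl

/-- The underlying permutation of an element of the hyperoctahedral group. -/
def pp {n : ℕ} (w : BWn n) : Perm (Fin n) := ((eqvBWn n).symm w).1

/-- The signs of an element of the hyperoctahedral group. -/
def sg {n : ℕ} (w : BWn n) (i : Fin n) : ℂ := if ((eqvBWn n).symm w).2 i then -1 else 1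

lemma eqvBWn_mul {n : ℕ} (x y : Perm (Fin n) × (Fin n → Bool)) :
    eqvBWn n x * eqvBWn n y = eqvBWn n (x.1 * y.1, fun i => xor (x.2 (y.1 i)) (y.2 i)) :=
  Subtype.ext (signedPerm_mul ..)

@[simp] lemma pp_eqvBWn {n : ℕ} (x : Perm (Fin n) × (Fin n → Bool)) :
    pp (eqvBWn n x) = x.1 := by simp [pp]

@[simp] lemma sg_eqvBWn {n : ℕ} (x : Perm (Fin n) × (Fin n → Bool)) (i : Fin n) :
    sg (eqvBWn n x) i = if x.2 i then -1 else 1 := by simp [sg]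

@[simp] lemma pp_mul {n : ℕ} (v w : BWn n) : pp (v * w) = pp v * pp w := by
  obtain ⟨x, rfl⟩ := (eqvBWn n).surjective v
  obtain ⟨y, rfl⟩ := (eqvBWn n).surjective w
  simp [eqvBWn_mul]

lemma sg_mul {n : ℕ} (v w : BWn n) (i : Fin n) : sg (v * w) i = sg v (pp w i) * sg w i := by
  obtain ⟨x, rfl⟩ := (eqvBWn n).surjective v
  obtain ⟨y, rfl⟩ := (eqvBWn n).surjective w
  rw [eqvBWn_mul]
  cases h : x.2 (y.1 i) <;> cases h' : y.2 i <;> simp [h, h']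

@[simp] lemma pp_one {n : ℕ} : pp (1 : BWn n) = 1 := by
  simpa using pp_mul (1 : BWn n) 1

lemma sg_sq {n : ℕ} (w : BWn n) (i : Fin n) : sg w i * sg w i = 1 := by
  unfold sg; split_ifs <;> simp

@[simp] lemma sg_one {n : ℕ} (i : Fin n) : sg (1 : BWn n) i = 1 := by
  have := sg_mul (1 : BWn n) 1 i
  rw [mul_one, pp_one, Perm.one_apply, sg_sq] at this
  exact this

@[simp] lemma pp_inv {n : ℕ} (w : BWn n) : pp w⁻¹ = (pp w)⁻¹ := by
  rw [eq_inv_iff_mul_eq_one, ← pp_mul, inv_mul_cancel, pp_one]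

lemma sg_inv {n : ℕ} (w : BWn n) (i : Fin n) : sg w⁻¹ (pp w i) = sg w i := by
  have h := sg_mul w⁻¹ w i
  rw [inv_mul_cancel, sg_one] at h
  have h2 := sg_sq w i
  calc sg w⁻¹ (pp w i) = sg w⁻¹ (pp w i) * (sg w i * sg w i) := by rw [h2, mul_one]
    _ = sg w i := by rw [← mul_assoc, ← h, one_mul]

lemma apply_inl {n : ℕ} (w : BWn n) (i : Fin n) :
    (w : PG n) (Sum.inl i) = if sg w i = 1 then Sum.inl (pp w i) else Sum.inr (pp w i) := by
  obtain ⟨x, rfl⟩ := (eqvBWn n).surjective w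
  cases h : x.2 i <;> norm_num [h]

lemma sg_eq {n : ℕ} (w : BWn n) (i : Fin n) : sg w i = 1 ∨ sg w i = -1 := by
  unfold sg; split_ifs <;> simp

/-- The diagonal matrix coefficient of `w` at the monomial with exponent vector `e`. -/
def diagCoeff {n : ℕ} (e : Fin n → ℕ) (w : BWn n) : ℂ :=
  if e ∘ pp w = e then ∏ i, sg w i ^ e i else 0

lemma diagCoeff_comp {n : ℕ} (e : Fin n → ℕ) (x w : BWn n) :
    diagCoeff (e ∘ pp x) w = diagCoeff e (x * w * x⁻¹) := by
  have hiff : (e ∘ pp x) ∘ pp w = e ∘ pp x ↔ e ∘ pp (x * w * x⁻¹) = e := by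
    constructor
    · intro h
      funext i
      simpa using congrFun h ((pp x)⁻¹ i)
    · intro h
      funext i
      simpa using congrFun h (pp x i)
  unfold diagCoeff
  by_cases h : (e ∘ pp x) ∘ pp w = e ∘ pp x
  · rw [if_pos h, if_pos (hiff.1 h),
      ← Equiv.prod_comp (pp x) (fun i => sg (x * w * x⁻¹) i ^ e i)]
    have h1 : ∀ i, sg (x * w * x⁻¹) (pp x i) ^ e (pp x i) =
        sg x (pp w i) ^ (e ∘ pp x) (pp w i) * sg w i ^ (e ∘ pp x) i *
          sg x i ^ (e ∘ pp x) i := fun i => by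
      rw [sg_mul, sg_mul, sg_inv, pp_inv, show (pp x)⁻¹ (pp x i) = i by simp, mul_pow, mul_pow]
      rw [show (e ∘ pp x) (pp w i) = e (pp x i) from congrFun h i]
      rfl
    rw [Finset.prod_congr rfl fun i _ => h1 i, prod_mul_distrib, prod_mul_distrib]
    rw [Equiv.prod_comp (pp w) (fun i => sg x i ^ (e ∘ pp x) i), mul_right_comm, ← prod_mul_distrib]
    simp [← mul_pow, sg_sq]
  · rw [if_neg h, if_neg (mt hiff.2 h)]

lemma diagCoeff_inv {n : ℕ} (e : Fin n → ℕ) (w : BWn n) :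
    diagCoeff e w⁻¹ = diagCoeff e w := by
  have hiff : e ∘ pp w⁻¹ = e ↔ e ∘ pp w = e := by
    constructor <;> intro h <;> funext i
    · simpa using (congrFun h (pp w i)).symm
    · simpa using (congrFun h ((pp w)⁻¹ i)).symm
  unfold diagCoeff
  by_cases h : e ∘ pp w = e
  · rw [if_pos h, if_pos (hiff.2 h), ← Equiv.prod_comp (pp w)]
    refine Finset.prod_congr rfl fun i _ => ?_
    rw [sg_inv, show e (pp w i) = e i from congrFun h i]
  · rw [if_neg h, if_neg (mt hiff.1 h)]

/-- A finite set of exponent vectors stable under permutations of the variables. -/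
def PermStable {n : ℕ} (Y : Finset (Fin n → ℕ)) : Prop :=
  ∀ e ∈ Y, ∀ u : Perm (Fin n), e ∘ u ∈ Y

/-- The representation of the hyperoctahedral group on the span of a permutation-stable set of
monomials. -/
def monoRep {n : ℕ} (Y : Finset (Fin n → ℕ)) (hY : PermStable Y) :
    Representation ℂ (BWn n) (EuclideanSpace ℂ Y) where
  toFun w :=
    { toFun := fun v => WithLp.toLp 2 fun e =>
        (∏ i, sg w i ^ e.1 (pp w i)) * v ⟨e.1 ∘ pp w, hY _ e.2 _⟩
      map_add' := fun v v' => by ext e; simp [mul_add]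
      map_smul' := fun c v => by ext e; simp [mul_left_comm] }
  map_one' := by ext v e; simp
  map_mul' v w := by
    ext x e
    simp only [LinearMap.coe_mk, AddHom.coe_mk, Module.End.mul_apply, pp_mul, Perm.coe_mul]
    rw [← mul_assoc]
    congr 1
    simp only [sg_mul, mul_pow, prod_mul_distrib, Function.comp_apply]
    rw [Equiv.prod_comp (pp w) (fun i => sg v i ^ e.1 (pp v i))]

lemma monoRep_apply {n : ℕ} (Y : Finset (Fin n → ℕ)) (hY : PermStable Y) (w : BWn n)
    (v : EuclideanSpace ℂ Y) (e : Y) :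
    monoRep Y hY w v e = (∏ i, sg w i ^ e.1 (pp w i)) * v ⟨e.1 ∘ pp w, hY _ e.2 _⟩ := rfl

lemma character_monoRep {n : ℕ} (Y : Finset (Fin n → ℕ)) (hY : PermStable Y) (w : BWn n) :
    (monoRep Y hY).character w = ∑ e ∈ Y, diagCoeff e w := by
  classical
  rw [Representation.character, LinearMap.trace_eq_sum_inner _ (EuclideanSpace.basisFun Y ℂ),
    ← Finset.sum_coe_sort Y]
  refine Finset.sum_congr rfl fun e _ => ?_
  rw [EuclideanSpace.basisFun_inner, monoRep_apply, diagCoeff]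
  simp only [EuclideanSpace.basisFun_apply, PiLp.single_apply, Subtype.ext_iff]
  split_ifs with h
  · rw [mul_one]
    exact Finset.prod_congr rfl fun i _ => by rw [show e.1 (pp w i) = e.1 i from congrFun h i]
  · rw [mul_zero]

lemma inner_monoRep {n : ℕ} (Y : Finset (Fin n → ℕ)) (hY : PermStable Y) (w : BWn n)
    (v v' : EuclideanSpace ℂ Y) :
    inner ℂ (monoRep Y hY w v) (monoRep Y hY w v') = inner ℂ v v' := by
  simp only [PiLp.inner_apply, monoRep_apply, RCLike.inner_apply]
  let σ : Perm Y :=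
    { toFun := fun e => ⟨e.1 ∘ pp w, hY _ e.2 _⟩
      invFun := fun e => ⟨e.1 ∘ ((pp w)⁻¹ : Perm (Fin n)), hY _ e.2 _⟩
      left_inv := fun e => Subtype.ext (by funext i; simp)
      right_inv := fun e => Subtype.ext (by funext i; simp) }
  rw [← Equiv.sum_comp σ (fun e => v' e * (starRingEnd ℂ) (v e))]
  refine Finset.sum_congr rfl fun e _ => ?_
  have hs : ∀ i, (starRingEnd ℂ) (sg w i) = sg w i := fun i => by
    rcases sg_eq w i with h | h <;> simp [h]
  have h1 : (∏ i, sg w i ^ e.1 (pp w i)) * (∏ i, sg w i ^ e.1 (pp w i)) = 1 := by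
    simp [← prod_mul_distrib, ← mul_pow, sg_sq]
  simp only [map_mul, map_prod, map_pow, hs]
  calc _ = ((∏ i, sg w i ^ e.1 (pp w i)) * (∏ i, sg w i ^ e.1 (pp w i))) *
        (v' (σ e) * (starRingEnd ℂ) (v (σ e))) := by
        simp only [σ, Equiv.coe_fn_mk]; ring
    _ = _ := by rw [h1, one_mul]

/-- The exponent vectors of degree `d`. -/
def degExp (n d : ℕ) : Finset (Fin n → ℕ) := Finset.piAntidiag Finset.univ d

@[simp] lemma mem_degExp {n d : ℕ} {e : Fin n → ℕ} : e ∈ degExp n d ↔ ∑ i, e i = d := by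
  simp [degExp]

lemma permStable_degExp (n d : ℕ) : PermStable (degExp n d) := fun e he u => by
  rw [mem_degExp] at he ⊢
  rw [← he]
  exact Equiv.sum_comp u e

lemma pp_pow {n : ℕ} (w : BWn n) (k : ℕ) (i : Fin n) : pp (w ^ k) i = (pp w)^[k] i := by
  induction k with
  | zero => simp
  | succ k ih => rw [pow_succ', pp_mul, Perm.mul_apply, ih, Function.iterate_succ_apply']

lemma sg_pow {n : ℕ} (w : BWn n) (k : ℕ) (i : Fin n) :
    sg (w ^ k) i = ∏ t ∈ range k, sg w ((pp w)^[t] i) := by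
  induction k with
  | zero => simp
  | succ k ih => rw [pow_succ', sg_mul, ih, pp_pow, prod_range_succ, mul_comm]

/-- The diagonal coefficient at `i` of the reflection representation. -/
def reflCoeff {n : ℕ} (i : Fin n) (w : BWn n) : ℂ := if pp w i = i then sg w i else 0

lemma reflChar_eq {n : ℕ} (w : BWn n) : reflChar (w : PG n) = ∑ i, reflCoeff i w := by
  unfold reflChar Matrix.trace
  refine Finset.sum_congr rfl fun i _ => ?_
  rw [Matrix.diag_apply, Mrefl, Matrix.of_apply, apply_inl, reflCoeff]
  rcases sg_eq w i with h | h <;> by_cases h' : pp w i = i <;>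
    norm_num [h, h'] <;> exact nofun

/-- The indicator of the cycle of `i`. -/
def cycInd {n : ℕ} (u : Perm (Fin n)) (i x : Fin n) : ℕ :=
  open scoped Classical in if u.SameCycle i x then 1 else 0

lemma cycInd_apply {n : ℕ} (u : Perm (Fin n)) (i x : Fin n) :
    cycInd u i (u x) = cycInd u i x := by
  simp [cycInd]

lemma cycInd_self {n : ℕ} (u : Perm (Fin n)) (i : Fin n) : cycInd u i i = 1 :=
  if_pos (Perm.SameCycle.refl _ _)

lemma prod_cycInd {n : ℕ} {M : Type*} [CommMonoid M] (u : Perm (Fin n)) (i : Fin n)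
    (f : Fin n → M) : ∏ x, f x ^ cycInd u i x =
      ∏ t ∈ range (Function.minimalPeriod u i), f (u^[t] i) := by
  classical
  have himg : (Finset.univ.filter fun x => u.SameCycle i x) =
      (range (Function.minimalPeriod u i)).image fun t => u^[t] i := by
    ext x
    simp only [mem_filter, Finset.mem_univ, true_and, Finset.mem_image, Finset.mem_range]
    constructor
    · intro h
      obtain ⟨k, hk⟩ := h.exists_nat_pow_eq
      have hpos : 0 < Function.minimalPeriod u i :=
        Function.minimalPeriod_pos_of_mem_periodicPts
          (Function.Injective.mem_periodicPts u.injective i)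
      refine ⟨k % Function.minimalPeriod u i, Nat.mod_lt _ hpos, ?_⟩
      rw [Function.iterate_mod_minimalPeriod_eq, ← hk, Equiv.Perm.iterate_eq_pow]
    · rintro ⟨t, -, rfl⟩
      rw [Equiv.Perm.iterate_eq_pow]
      exact ⟨t, by simp⟩
  rw [← Finset.prod_image (g := fun t => u^[t] i) (f := f), ← himg, prod_filter]
  · refine Finset.prod_congr rfl fun x _ => ?_
    unfold cycInd
    split_ifs <;> simp
  · intro a ha b hb hab
    exact Function.iterate_injOn_Iio_minimalPeriod (by simpa using ha) (by simpa using hb) hab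

lemma diagCoeff_add_cycInd {n : ℕ} (w : BWn n) (i : Fin n) (e : Fin n → ℕ) :
    diagCoeff (e + cycInd (pp w) i) w =
      sg (w ^ Function.minimalPeriod (pp w) i) i * diagCoeff e w := by
  have hiff : (e + cycInd (pp w) i) ∘ pp w = e + cycInd (pp w) i ↔ e ∘ pp w = e := by
    simp [funext_iff, cycInd_apply]
  rw [diagCoeff, diagCoeff, sg_pow, ← prod_cycInd]
  simp only [hiff, Pi.add_apply, pow_add, prod_mul_distrib]
  split_ifs <;> ring

lemma sum_cycInd {n : ℕ} (u : Perm (Fin n)) (i : Fin n) :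
    ∑ x, cycInd u i x = Function.minimalPeriod u i := by
  have := prod_cycInd u i (fun _ => Multiplicative.ofAdd (1 : ℕ))
  apply_fun Multiplicative.toAdd at this
  simpa using this

lemma cycInd_le {n : ℕ} {w : BWn n} {i : Fin n} {e : Fin n → ℕ} (he : e ∘ pp w = e)
    (hi : 1 ≤ e i) (x : Fin n) : cycInd (pp w) i x ≤ e x := by
  unfold cycInd
  split_ifs with h
  · obtain ⟨k, hk⟩ := h.exists_nat_pow_eq
    have : ∀ k, e (((pp w) ^ k) i) = e i := fun k => by
      induction k with
      | zero => simp
      | succ k ih => rw [pow_succ', Perm.mul_apply, ← ih]; exact congrFun he _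
    rw [← hk, this]
    exact hi
  · exact Nat.zero_le _

/-- Removing the cycle of `i` from an exponent vector. -/
lemma sum_degExp_cycle {n : ℕ} (w : BWn n) (i : Fin n) (D : ℕ) (g : ℕ → ℂ) (hg : g 0 = 0) :
    ∑ e ∈ degExp n (D + Function.minimalPeriod (pp w) i), g (e i) * diagCoeff e w =
      sg (w ^ Function.minimalPeriod (pp w) i) i *
        ∑ e ∈ degExp n D, g (e i + 1) * diagCoeff e w := by
  rw [Finset.mul_sum]
  symm
  refine Finset.sum_of_injOn (fun e => e + cycInd (pp w) i) ?_ ?_ ?_ ?_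
  · intro a _ b _ hab
    exact add_right_cancel hab
  · intro e he
    simp only [mem_coe, mem_degExp] at he ⊢
    simp [sum_add_distrib, he, sum_cycInd]
  · intro e he hne
    by_cases h0 : e i = 0
    · rw [h0, hg, zero_mul]
    by_cases hw : e ∘ pp w = e
    · exfalso
      apply hne
      have hle := cycInd_le hw (Nat.one_le_iff_ne_zero.2 h0)
      refine ⟨e - cycInd (pp w) i, ?_, tsub_add_cancel_of_le hle⟩
      simp only [mem_coe, mem_degExp, Pi.sub_apply] at he ⊢
      rw [Finset.sum_tsub_distrib _ fun x _ => hle x, he, sum_cycInd, Nat.add_sub_cancel]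
    · rw [diagCoeff, if_neg hw, mul_zero]
  · intro e _
    rw [diagCoeff_add_cycInd, Pi.add_apply, cycInd_self]
    ring

lemma sum_degExp_of_lt {n : ℕ} (w : BWn n) (i : Fin n) (D : ℕ) (g : ℕ → ℂ) (hg : g 0 = 0)
    (hD : D < Function.minimalPeriod (pp w) i) :
    ∑ e ∈ degExp n D, g (e i) * diagCoeff e w = 0 := by
  refine Finset.sum_eq_zero fun e he => ?_
  by_cases h0 : e i = 0
  · rw [h0, hg, zero_mul]
  by_cases hw : e ∘ pp w = e
  · have hle := cycInd_le hw (Nat.one_le_iff_ne_zero.2 h0)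
    have := Finset.sum_le_sum fun x (_ : x ∈ Finset.univ) => hle x
    rw [sum_cycInd, mem_degExp.1 he] at this
    omega
  · rw [diagCoeff, if_neg hw, mul_zero]

/-- The local form of Newton's identity. -/
lemma newton_local {n : ℕ} (w : BWn n) (i : Fin n) (D : ℕ) :
    ∑ e ∈ degExp n D, (e i : ℂ) * diagCoeff e w =
      ∑ k ∈ range D, reflCoeff i (w ^ (k + 1)) * ∑ e ∈ degExp n (D - (k + 1)), diagCoeff e w := by
  set l := Function.minimalPeriod (pp w) i with hl
  have hl0 : 0 < l := Function.minimalPeriod_pos_of_mem_periodicPts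
    (Function.Injective.mem_periodicPts (pp w).injective i)
  have hzero : ∀ k, 0 < k → k < l → reflCoeff i (w ^ k) = 0 := fun k hk hkl => by
    rw [reflCoeff, if_neg]
    rw [pp_pow]
    exact Function.not_isPeriodicPt_of_pos_of_lt_minimalPeriod hk.ne' hkl
  have hper : pp (w ^ l) i = i := by rw [pp_pow]; exact Function.iterate_minimalPeriod
  have hself : reflCoeff i (w ^ l) = sg (w ^ l) i := if_pos hper
  have hshift : ∀ k, reflCoeff i (w ^ (k + l)) = sg (w ^ l) i * reflCoeff i (w ^ k) := fun k => by
    rw [reflCoeff, reflCoeff, pow_add, pp_mul, sg_mul, Perm.mul_apply, hper]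
    split_ifs <;> ring
  induction D using Nat.strong_induction_on with
  | _ D ih =>
    rcases lt_or_ge D l with hD | hD
    · rw [sum_degExp_of_lt w i D (fun m => (m : ℂ)) Nat.cast_zero hD]
      refine (Finset.sum_eq_zero fun k hk => ?_).symm
      rw [hzero (k + 1) k.succ_pos (by rw [Finset.mem_range] at hk; omega), zero_mul]
    · obtain ⟨D, rfl⟩ := Nat.exists_eq_add_of_le' hD
      have hfirst : ∑ k ∈ range l, reflCoeff i (w ^ (k + 1)) *
          ∑ e ∈ degExp n (D + l - (k + 1)), diagCoeff e w =
          sg (w ^ l) i * ∑ e ∈ degExp n D, diagCoeff e w := by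
        rw [Finset.sum_eq_single (l - 1)]
        · rw [Nat.sub_add_cancel hl0, hself, Nat.add_sub_cancel]
        · intro k hk hne
          rw [Finset.mem_range] at hk
          rw [hzero (k + 1) k.succ_pos (by omega), zero_mul]
        · intro h
          exact absurd (Finset.mem_range.2 (by omega)) h
      rw [sum_degExp_cycle w i D (fun m => (m : ℂ)) Nat.cast_zero, ← hl, add_comm D l,
        Finset.sum_range_add, add_comm l D, hfirst]
      simp only [Nat.cast_add, Nat.cast_one, add_mul, one_mul, sum_add_distrib]
      rw [ih D (by omega), mul_add, add_comm]
      congr 1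
      rw [Finset.mul_sum]
      refine Finset.sum_congr rfl fun k _ => ?_
      rw [← mul_assoc, ← hshift, show l + k + 1 = k + 1 + l by ring, Nat.add_sub_add_right]

lemma symChar_reflChar {n : ℕ} (w : BWn n) (d : ℕ) :
    symChar (resChar (BWn n) (reflChar (n := n))) d w = ∑ e ∈ degExp n d, diagCoeff e w := by
  induction d using Nat.strong_induction_on with
  | _ d ih =>
    rcases d with _ | d
    · have : degExp n 0 = {0} := by ext e; simp [funext_iff]
      rw [symChar, this]
      simp [diagCoeff]
    · rw [symChar]
      have hd : (d : ℂ) + 1 ≠ 0 := by exact_mod_cast Nat.succ_ne_zero d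
      rw [inv_mul_eq_iff_eq_mul₀ hd]
      have h1 : ((d : ℂ) + 1) * ∑ e ∈ degExp n (d + 1), diagCoeff e w =
          ∑ i, ∑ e ∈ degExp n (d + 1), (e i : ℂ) * diagCoeff e w := by
        rw [Finset.sum_comm, Finset.mul_sum]
        refine Finset.sum_congr rfl fun e he => ?_
        rw [← Finset.sum_mul]
        congr 1
        rw [mem_degExp] at he
        exact_mod_cast he.symm
      rw [h1, Finset.sum_congr rfl fun i _ => newton_local w i (d + 1), Finset.sum_comm]
      refine Finset.sum_congr rfl fun k hk => ?_
      rw [ih (d - k) (by omega), ← Finset.sum_mul, Nat.add_sub_add_right]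
      congr 1
      exact reflChar_eq (w ^ (k + 1))

/-- The number of times a value is taken. -/
def content {n : ℕ} {α : Type*} [DecidableEq α] (f : Fin n → α) (a : α) : ℕ :=
  (Finset.univ.filter fun i => f i = a).card

lemma content_comp {n : ℕ} {α : Type*} [DecidableEq α] (f : Fin n → α) (u : Perm (Fin n)) :
    content (f ∘ u) = content f := by
  funext a
  exact Finset.card_bijective u u.bijective (by simp)

lemma sum_content {n : ℕ} {α : Type*} [DecidableEq α] [Fintype α] (f : Fin n → α) :
    ∑ a, content f a = n := by
  have := Finset.card_eq_sum_card_fiberwise (f := f) (s := Finset.univ) (t := Finset.univ)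
    (fun _ _ => by simp)
  simpa [content] using this.symm

lemma sum_comp_eq_sum_content {n : ℕ} {α : Type*} [DecidableEq α] (f : Fin n → α)
    (s : Finset α) (hf : ∀ i, f i ∈ s) (g : α → ℕ) :
    ∑ i, g (f i) = ∑ a ∈ s, content f a * g a := by
  rw [← Finset.sum_fiberwise_of_maps_to (fun i _ => hf i)]
  refine Finset.sum_congr rfl fun a _ => ?_
  rw [Finset.sum_congr rfl fun i hi => by rw [(Finset.mem_filter.1 hi).2], sum_const, smul_eq_mul,
    content]

lemma exists_perm_of_content_eq {n : ℕ} {α : Type*} [DecidableEq α] {f g : Fin n → α}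
    (h : content f = content g) : ∃ u : Perm (Fin n), g = f ∘ u := by
  have hc : ∀ a, Nonempty ({i // g i = a} ≃ {i // f i = a}) := fun a => by
    refine Fintype.card_eq.1 ?_
    rw [Fintype.card_subtype, Fintype.card_subtype]
    exact (congrFun h a).symm
  let E := fun a => (hc a).some
  refine ⟨(Equiv.sigmaFiberEquiv g).symm.trans
    ((Equiv.sigmaCongrRight E).trans (Equiv.sigmaFiberEquiv f)), ?_⟩
  funext i
  exact (E (g i) ⟨i, rfl⟩).2.symm

lemma blockOf_eq {N : ℕ} {c : ℕ → ℕ} {i b : ℕ} (hb : b < N)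
    (h1 : ∑ b' ∈ range b, c b' ≤ i) (h2 : i < ∑ b' ∈ range (b + 1), c b') :
    blockOf N c i = b := by
  have hmono : Monotone fun m => ∑ b' ∈ range m, c b' := fun x y hxy =>
    Finset.sum_le_sum_of_subset (Finset.range_mono hxy)
  have : ((Finset.range N).filter fun b => ∑ b' ∈ Finset.range (b + 1), c b' ≤ i) = range b := by
    ext x
    simp only [Finset.mem_filter, Finset.mem_range]
    constructor
    · rintro ⟨-, hx⟩
      by_contra! hle
      exact absurd (h2.trans_le (hmono (by omega : b + 1 ≤ x + 1))) (not_lt.2 hx)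
    · intro hx
      exact ⟨hx.trans hb, (hmono (by omega : x + 1 ≤ b)).trans h1⟩
  rw [blockOf, this, card_range]

lemma exists_block {N : ℕ} (c : ℕ → ℕ) {i : ℕ} (hi : i < ∑ b ∈ range N, c b) :
    ∃ b < N, ∑ b' ∈ range b, c b' ≤ i ∧ i < ∑ b' ∈ range (b + 1), c b' := by
  induction N with
  | zero => simp at hi
  | succ N ih =>
    by_cases h : i < ∑ b ∈ range N, c b
    · obtain ⟨b, hb, h'⟩ := ih h
      exact ⟨b, hb.trans N.lt_succ_self, h'⟩
    · exact ⟨N, N.lt_succ_self, not_lt.1 h, hi⟩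

lemma blockOf_lt {N : ℕ} {c : ℕ → ℕ} {i : ℕ} (hi : i < ∑ b ∈ range N, c b) :
    blockOf N c i < N := by
  obtain ⟨b, hb, h1, h2⟩ := exists_block c hi
  rwa [blockOf_eq hb h1 h2]

lemma content_blockOf {n N : ℕ} {c : ℕ → ℕ} (h : ∑ b ∈ range N, c b = n) {b : ℕ} (hb : b < N) :
    content (fun i : Fin n => blockOf N c i) b = c b := by
  have hS : ∑ b' ∈ range (b + 1), c b' ≤ n := by
    rw [← h]
    exact Finset.sum_le_sum_of_subset (Finset.range_mono hb)
  have key : (Finset.univ.filter fun i : Fin n => blockOf N c i = b).map Fin.valEmbedding =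
      Finset.Ico (∑ b' ∈ range b, c b') (∑ b' ∈ range (b + 1), c b') := by
    ext x
    simp only [Finset.mem_map, Finset.mem_filter, Finset.mem_univ, true_and, Fin.valEmbedding_apply,
      Finset.mem_Ico]
    constructor
    · rintro ⟨i, hi, rfl⟩
      obtain ⟨b', hb', h1, h2⟩ := exists_block c (i.2.trans_eq h.symm)
      rw [blockOf_eq hb' h1 h2] at hi
      exact hi ▸ ⟨h1, h2⟩
    · rintro ⟨h1, h2⟩
      exact ⟨⟨x, h2.trans_le hS⟩, blockOf_eq hb h1 h2, rfl⟩
  rw [content, ← Finset.card_map Fin.valEmbedding, key, Nat.card_Ico, sum_range_succ,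
    Nat.add_sub_cancel_left]

/-- The exponents attached to the two families of blocks: even for the first one, odd for the
second one. -/
def expo {r s : ℕ} : Fin r ⊕ Fin s → ℕ := Sum.elim (fun i => 2 * i) (fun j => 2 * j + 1)

lemma expo_injective {r s : ℕ} : Function.Injective (expo (r := r) (s := s)) := by
  rintro (x | x) (y | y) h <;> simp only [expo, Sum.elim_inl, Sum.elim_inr] at h
  · exact congrArg _ (Fin.ext (by omega))
  · omega
  · omega
  · exact congrArg _ (Fin.ext (by omega))

/-- The position of a block in the concatenation of two families of blocks. -/
def pos {r s : ℕ} : Fin r ⊕ Fin s → ℕ := Sum.elim (fun i => i) (fun j => r + j)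

lemma pos_injective {r s : ℕ} : Function.Injective (pos (r := r) (s := s)) := by
  rintro (x | x) (y | y) h <;> simp only [pos, Sum.elim_inl, Sum.elim_inr] at h
  · exact congrArg _ (Fin.ext h)
  · have := x.2; omega
  · have := y.2; omega
  · exact congrArg _ (Fin.ext (by omega))

lemma exists_pos_eq {r s b : ℕ} (hb : b < r + s) : ∃ x : Fin r ⊕ Fin s, pos x = b := by
  by_cases h : b < r
  · exact ⟨Sum.inl ⟨b, h⟩, rfl⟩
  · refine ⟨Sum.inr ⟨b - r, by omega⟩, ?_⟩
    simp only [pos, Sum.elim_inr]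
    omega

lemma mem_blkSub_B' {n : ℕ} {α : Type*} (g : Fin n → α) {ν : α → ℕ} (hν : Function.Injective ν)
    (w : BWn n) : (w : PG n) ∈ blkSub n (fun i => ν (g i)) (fun _ => BTy.B) ↔ g ∘ pp w = g := by
  obtain ⟨x, rfl⟩ := (eqvBWn n).surjective w
  rw [mem_blkSub_B, pp_eqvBWn]
  constructor
  · rintro ⟨u, s, hu, h⟩
    rw [coe_eqvBWn] at h
    obtain ⟨rfl, -⟩ := signedPerm_injective h
    exact funext fun i => hν (hu i)
  · intro h
    exact ⟨x.1, x.2, fun i => congrArg ν (congrFun h i), by rw [coe_eqvBWn]⟩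

lemma epsOn_eq {n r s : ℕ} (g : Fin n → Fin r ⊕ Fin s) (w : BWn n) :
    epsOn {i | r ≤ pos (g i)} (w : PG n) = ∏ i, sg w i ^ expo (g i) := by
  classical
  rw [epsOn, finprod_eq_prod_of_fintype]
  refine Finset.prod_congr rfl fun i _ => ?_
  have hex : (∃ j, (w : PG n) (Sum.inl i) = Sum.inr j) ↔ sg w i = -1 := by
    rw [apply_inl]
    rcases sg_eq w i with h | h <;> norm_num [h]
    exact nofun
  simp only [Set.mem_ofPred_eq, hex]
  rcases g i with x | x
  · have := x.2
    rw [if_neg (by simp [pos])]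
    rcases sg_eq w i with h | h <;> simp [h, expo]
  · rcases sg_eq w i with h | h <;> norm_num [h, expo, pos, pow_succ]

lemma blkSub_B_le {n : ℕ} (f : Fin n → ℕ) : blkSub n f (fun _ => BTy.B) ≤ BWn n := fun y hy => by
  obtain ⟨u, s, -, h⟩ := (mem_blkSub_B _ _).1 hy
  exact (mem_BWn _).2 ⟨u, s, h⟩

lemma indChar_blkSub_B {n r s : ℕ} (g : Fin n → Fin r ⊕ Fin s) (w : BWn n) :
    indChar (blkSub n (fun i => pos (g i)) (fun _ => BTy.B)) (BWn n)
      (resChar _ (epsOn {i | r ≤ pos (g i)})) w =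
    ∑ f : Fin n → Fin r ⊕ Fin s, if content g = content f then diagCoeff (expo ∘ f) w else 0 := by
  classical
  rw [indChar, finsum_eq_sum_of_fintype]
  have hterm : ∀ x : BWn n,
      (if h : (x : PG n) * w * (x : PG n)⁻¹ ∈ blkSub n (fun i => pos (g i)) (fun _ => BTy.B) then
        resChar (blkSub n (fun i => pos (g i)) (fun _ => BTy.B)) (epsOn {i | r ≤ pos (g i)}) ⟨_, h⟩
        else 0) = diagCoeff (expo ∘ g ∘ pp x) w := fun x => by
    rw [← Function.comp_assoc, diagCoeff_comp, diagCoeff]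
    have h1 : (x : PG n) * w * (x : PG n)⁻¹ ∈ blkSub n (fun i => pos (g i)) (fun _ => BTy.B) ↔ _ :=
      mem_blkSub_B' g pos_injective (x * w * x⁻¹)
    have h2 : (expo ∘ g) ∘ pp (x * w * x⁻¹) = expo ∘ g ↔ g ∘ pp (x * w * x⁻¹) = g := by
      simp [funext_iff, expo_injective.eq_iff]
    have h3 := epsOn_eq g (x * w * x⁻¹)
    by_cases h : g ∘ pp (x * w * x⁻¹) = g
    · rw [dif_pos (h1.2 h), if_pos (h2.2 h)]
      exact h3
    · rw [dif_neg (mt h1.1 h), if_neg (mt h2.1 h)]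
  rw [Finset.sum_congr rfl fun x _ => hterm x,
    ← Finset.sum_fiberwise (s := Finset.univ) (fun x : BWn n => g ∘ pp x), Finset.mul_sum]
  refine Finset.sum_congr rfl fun f _ => ?_
  rw [Finset.sum_congr rfl fun x hx => by rw [(Finset.mem_filter.1 hx).2], sum_const]
  by_cases h : content g = content f
  · obtain ⟨u, rfl⟩ := exists_perm_of_content_eq h
    rw [if_pos h]
    set x₀ := eqvBWn n (u, fun _ => false) with hx₀
    have hu : pp x₀ = u := by simp [hx₀]
    have hcard : (Finset.univ.filter fun x : BWn n => g ∘ pp x = g ∘ u).card =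
        Nat.card (blkSub n (fun i => pos (g i)) (fun _ => BTy.B)) := by
      rw [← Fintype.card_subtype, ← Nat.card_eq_fintype_card]
      refine Nat.card_congr
        { toFun := fun x => ⟨(x.1 * x₀⁻¹ : BWn n), (mem_blkSub_B' g pos_injective _).2 ?_⟩
          invFun := fun y => ⟨⟨y.1, blkSub_B_le _ y.2⟩ * x₀, ?_⟩
          left_inv := fun x => Subtype.ext (Subtype.ext (by simp))
          right_inv := fun y => by simp }
      · funext i
        have := congrFun x.2 (u⁻¹ i)
        simpa [pp_mul, hu, pp_inv] using this
      · funext i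
        have := congrFun ((mem_blkSub_B' g pos_injective ⟨y.1, blkSub_B_le _ y.2⟩).1 y.2) (u i)
        simpa [pp_mul, hu] using this
    rw [hcard, nsmul_eq_mul, inv_mul_cancel_left₀ (Nat.cast_ne_zero.2 Nat.card_pos.ne')]
  · rw [if_neg h, Finset.filter_false_of_mem, card_empty, zero_smul, mul_zero]
    rintro x - rfl
    exact h (content_comp g _).symm

/-- The pieces of the Jacobi-Trudi formula are the traces on the monomials of given content. -/
lemma indPiece_eq {n r s : ℕ} (c : Fin r → ℤ) (d : Fin s → ℤ) (w : BWn n) :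
    indPiece n r s c d w = ∑ f : Fin n → Fin r ⊕ Fin s,
      if (fun x => (content f x : ℤ)) = Sum.elim c d then diagCoeff (expo ∘ f) w else 0 := by
  classical
  rw [indPiece]
  split_ifs with hcond
  swap
  · refine (Finset.sum_eq_zero fun f _ => if_neg fun h => hcond ⟨fun i => ?_, fun j => ?_, ?_⟩).symm
    · exact (Int.natCast_nonneg _).trans_eq (congrFun h (Sum.inl i))
    · exact (Int.natCast_nonneg _).trans_eq (congrFun h (Sum.inr j))
    · have h2 := congrArg (Nat.cast : ℕ → ℤ) (sum_content f)
      rw [Nat.cast_sum, Finset.sum_congr rfl fun x _ => congrFun h x] at h2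
      simpa using h2
  obtain ⟨hc, hd, hn⟩ := hcond
  set cs : ℕ → ℕ := fun b =>
    if hb : b < r then (c ⟨b, hb⟩).toNat
    else if hb' : b - r < s then (d ⟨b - r, hb'⟩).toNat else 0 with hcs
  have hcspos : ∀ x : Fin r ⊕ Fin s, (cs (pos x) : ℤ) = Sum.elim c d x := by
    rintro (x | x)
    · simp [hcs, pos, hc]
    · simp [hcs, pos, hd]
  have hsum : ∑ b ∈ range (r + s), cs b = n := by
    rw [Finset.sum_range_add, Finset.sum_range, Finset.sum_range]
    zify
    rw [← hn]
    congr 1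
    · exact Finset.sum_congr rfl fun x _ => hcspos (Sum.inl x)
    · exact Finset.sum_congr rfl fun x _ => hcspos (Sum.inr x)
  choose g hg using fun i : Fin n => exists_pos_eq (blockOf_lt (i.2.trans_eq hsum.symm))
  have hcont : (fun x => (content g x : ℤ)) = Sum.elim c d := by
    funext x
    rw [← hcspos, ← content_blockOf hsum (b := pos x)]
    · simp only [content, ← hg, pos_injective.eq_iff]
    · rcases x with x | x <;> simp [pos]; omega
  have hset : ∀ f : Fin n → Fin r ⊕ Fin s, (fun x => (content f x : ℤ)) = Sum.elim c d ↔
      content g = content f := fun f => by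
    rw [← hcont, eq_comm]
    simp [funext_iff]
  have key : ∀ F : Fin n → ℕ, F = (fun i => pos (g i)) →
      indChar (blkSub n F (fun _ => BTy.B)) (BWn n) (resChar _ (epsOn {i | r ≤ F i})) w =
        ∑ f : Fin n → Fin r ⊕ Fin s,
          if content g = content f then diagCoeff (expo ∘ f) w else 0 := by
    rintro _ rfl
    exact indChar_blkSub_B g w
  simp only [hset]
  exact key _ (funext fun i => (hg i).symm)

/-- The coefficient of the monomials of given content in a product of two Jacobi-Trudi
determinants. -/
def stair₂ {r s : ℕ} (l : Fin r → ℕ) (m : Fin s → ℕ) (c : Fin r ⊕ Fin s → ℕ) : ℤ :=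
  stair l (fun i => c (Sum.inl i)) * stair m (fun j => c (Sum.inr j))

lemma stair_eq {r : ℕ} (α : Fin r → ℤ) (l : Fin r → ℕ) (hl : ∀ i, α i + (i.rev : ℕ) = l i)
    (c : Fin r → ℕ) : stair l c = ∑ σ : Perm (Fin r), (Perm.sign σ : ℤ) *
      if (fun i => (c i : ℤ)) = (fun i => α i - (i : ℕ) + ((σ i : ℕ) : ℤ)) then 1 else 0 := by
  refine Finset.sum_congr rfl fun σ _ => ?_
  congr 2
  simp only [funext_iff, eq_iff_iff]
  refine forall_congr' fun i => ?_
  have h1 := hl i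
  have h2 := Fin.val_rev i
  have h3 := Fin.val_rev (σ i)
  have h4 := i.2
  have h5 := (σ i).2
  omega

lemma chiB_eq {n r s : ℕ} {α : Fin r → ℤ} {β : Fin s → ℤ} {l : Fin r → ℕ} {m : Fin s → ℕ}
    (hl : ∀ i, α i + (i.rev : ℕ) = l i) (hm : ∀ j, β j + (j.rev : ℕ) = m j) (w : BWn n) :
    chiB n r s α β w = ∑ f : Fin n → Fin r ⊕ Fin s,
      (stair₂ l m (content f) : ℂ) * diagCoeff (expo ∘ f) w := by
  classical
  simp only [chiB, finsum_eq_sum_of_fintype, indPiece_eq, Finset.mul_sum]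
  rw [Finset.sum_congr rfl fun σ _ => Finset.sum_comm, Finset.sum_comm]
  refine Finset.sum_congr rfl fun f _ => ?_
  rw [stair₂, stair_eq α l hl, stair_eq β m hm]
  push_cast
  rw [Finset.sum_mul_sum, Finset.sum_mul]
  refine Finset.sum_congr rfl fun σ _ => ?_
  rw [Finset.sum_mul]
  refine Finset.sum_congr rfl fun τ _ => ?_
  have hiff : ∀ (c : Fin r → ℤ) (d : Fin s → ℤ), (fun x => (content f x : ℤ)) = Sum.elim c d ↔
      (fun i => (content f (Sum.inl i) : ℤ)) = c ∧ (fun j => (content f (Sum.inr j) : ℤ)) = d :=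
    fun c d => by simp [funext_iff]
  rw [if_congr (hiff _ _) rfl rfl]
  split_ifs <;> simp_all

lemma diagCoeff_eqvBWn {n : ℕ} (e : Fin n → ℕ) (x : Perm (Fin n) × (Fin n → Bool)) :
    diagCoeff e (eqvBWn n x) =
      if e ∘ x.1 = e then ∏ i, (if x.2 i then (-1 : ℂ) else 1) ^ e i else 0 := by
  simp [diagCoeff]

/-- Orthogonality of the diagonal coefficients. -/
lemma sum_diagCoeff_mul {n : ℕ} (e e' : Fin n → ℕ) :
    ∑ x, diagCoeff e (eqvBWn n x) * diagCoeff e' (eqvBWn n x) =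
      if ∀ i, Even (e i + e' i) then
        2 ^ n * ((Finset.univ.filter fun u : Perm (Fin n) => e ∘ u = e ∧ e' ∘ u = e').card : ℂ)
      else 0 := by
  classical
  rw [Fintype.sum_prod_type]
  have h : ∀ u : Perm (Fin n), ∑ t : Fin n → Bool,
      diagCoeff e (eqvBWn n (u, t)) * diagCoeff e' (eqvBWn n (u, t)) =
      (if e ∘ u = e ∧ e' ∘ u = e' then 1 else 0) * ∏ i, if Even (e i + e' i) then (2 : ℂ) else 0 :=
    fun u => by
    have h1 : ∀ i, (if Even (e i + e' i) then (2 : ℂ) else 0) =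
        ∑ b : Bool, (if b then (-1 : ℂ) else 1) ^ (e i + e' i) := fun i => by
      rw [Fintype.sum_bool, if_pos rfl, if_neg Bool.false_ne_true]
      split_ifs with h
      · norm_num [h.neg_one_pow]
      · norm_num [(Nat.not_even_iff_odd.1 h).neg_one_pow]
    rw [Finset.prod_congr rfl fun i _ => h1 i, Fintype.prod_sum, Finset.mul_sum]
    refine Finset.sum_congr rfl fun t _ => ?_
    rw [diagCoeff_eqvBWn, diagCoeff_eqvBWn]
    simp only [pow_add, prod_mul_distrib]
    split_ifs <;> simp_all
  rw [Finset.sum_congr rfl fun u _ => h u, ← Finset.sum_mul, Finset.sum_boole]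
  split_ifs with hev
  · rw [Finset.prod_congr rfl fun i _ => if_pos (hev i), mul_comm]
    simp
  · obtain ⟨i, hi⟩ := not_forall.1 hev
    rw [Finset.prod_eq_zero (Finset.mem_univ i) (if_neg hi), mul_zero]

/-- Summing a function of the content, weighted by the orders of the stabilizers. -/
lemma sum_content_stabilizer {n : ℕ} {α M : Type*} [Fintype α] [DecidableEq α] [AddCommMonoid M]
    (F : (α → ℕ) → M) :
    ∑ E : Fin n → α, (Finset.univ.filter fun u : Perm (Fin n) => E ∘ u = E).card • F (content E) =
      n.factorial • ∑ N ∈ Finset.piAntidiag Finset.univ n, F N := by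
  rw [← Finset.sum_fiberwise_of_maps_to (g := content) (t := Finset.piAntidiag Finset.univ n)
    (fun E _ => by simp [sum_content]), Finset.smul_sum]
  refine Finset.sum_congr rfl fun N hN => ?_
  have hN' : ∑ a, N a = n := by simpa using hN
  obtain ⟨E₀, hE₀⟩ : ∃ E₀ : Fin n → α, content E₀ = N := by
    have e : Fin n ≃ Σ a, Fin (N a) := Fintype.equivOfCardEq (by simp [hN'])
    refine ⟨fun i => (e i).1, funext fun a => ?_⟩
    rw [content, ← Fintype.card_subtype]
    rw [Fintype.card_congr (e.subtypeEquiv (q := fun x => x.1 = a) fun _ => Iff.rfl),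
      Fintype.card_congr (Equiv.sigmaSubtype a), Fintype.card_fin]
  have hstab : ∀ E ∈ Finset.univ.filter fun E : Fin n → α => content E = N,
      (Finset.univ.filter fun u : Perm (Fin n) => E ∘ u = E).card • F (content E) =
      (Finset.univ.filter fun u : Perm (Fin n) => E₀ ∘ u = E).card • F N := fun E hE => by
    have hE' := (Finset.mem_filter.1 hE).2
    obtain ⟨v, rfl⟩ := exists_perm_of_content_eq (hE₀.trans hE'.symm)
    rw [hE']
    congr 1
    refine Finset.card_bijective (Equiv.mulLeft v) (Equiv.bijective _) fun u => ?_
    simp [Function.comp_assoc, Perm.coe_mul]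
  rw [Finset.sum_congr rfl hstab, ← Finset.sum_smul]
  congr 1
  have h := Finset.card_eq_sum_card_fiberwise (s := (Finset.univ : Finset (Perm (Fin n))))
    (f := fun u : Perm (Fin n) => E₀ ∘ u) (t := Finset.univ.filter fun E : Fin n → α => content E = N)
    (fun u _ => by simp [content_comp, hE₀])
  rw [← h, Finset.card_univ, Fintype.card_perm, Fintype.card_fin]

/-- The types of the diagonal positions: pairs of blocks in the same family. -/
abbrev Diag (r s : ℕ) := (Fin r × Fin r) ⊕ (Fin s × Fin s)

lemma content_map {n : ℕ} {α β : Type*} [DecidableEq α] [DecidableEq β] [Fintype α]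
    (E : Fin n → α) (g : α → β) (b : β) :
    content (g ∘ E) b = ∑ a, if g a = b then content E a else 0 := by
  rw [← Finset.sum_filter, content]
  rw [Finset.card_eq_sum_card_fiberwise (f := E) (t := Finset.univ.filter fun a => g a = b)
    (fun i hi => by simpa using hi)]
  refine Finset.sum_congr rfl fun a ha => ?_
  rw [content, Finset.filter_filter]
  congr 1
  ext i
  have := (Finset.mem_filter.1 ha).2
  simp only [Function.comp_apply, Finset.mem_filter, Finset.mem_univ, true_and]
  exact ⟨fun h => h.2, fun h => ⟨by rw [h, this], h⟩⟩

lemma stair_ne_zero {r : ℕ} {l c : Fin r → ℕ} (h : stair l c ≠ 0) :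
    ∑ i, c i + ∑ i : Fin r, (i : ℕ) = ∑ i, l i := by
  obtain ⟨σ, -, hσ⟩ := Finset.exists_ne_zero_of_sum_ne_zero h
  have : (fun i => c i + ((σ i).rev : ℕ)) = l := by
    by_contra h'
    exact hσ (by rw [if_neg h', mul_zero])
  rw [← this, sum_add_distrib]
  congr 1
  exact (Equiv.sum_comp (σ.trans Fin.revPerm) (fun i : Fin r => (i : ℕ))).symm

/-- The first coordinate of a diagonal position. -/
def diagFst {r s : ℕ} : Diag r s → Fin r ⊕ Fin s := Sum.map Prod.fst Prod.fst

/-- The second coordinate of a diagonal position. -/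
def diagSnd {r s : ℕ} : Diag r s → Fin r ⊕ Fin s := Sum.map Prod.snd Prod.snd

/-- The summand indexed by a family of multiplicities of the diagonal positions. -/
def stairProd {r s : ℕ} (l : Fin r → ℕ) (m : Fin s → ℕ) (N : Diag r s → ℕ) : ℤ :=
  (stair l (fun i => ∑ j, N (Sum.inl (i, j))) * stair l (fun j => ∑ i, N (Sum.inl (i, j)))) *
    (stair m (fun i => ∑ j, N (Sum.inr (i, j))) * stair m (fun j => ∑ i, N (Sum.inr (i, j))))

lemma stair₂_mul_stair₂ {n r s : ℕ} (l : Fin r → ℕ) (m : Fin s → ℕ) (E : Fin n → Diag r s) :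
    stair₂ l m (content (diagFst ∘ E)) * stair₂ l m (content (diagSnd ∘ E)) =
      stairProd l m (content E) := by
  simp only [stair₂, stairProd, content_map, diagFst, diagSnd, Fintype.sum_sum_type, Sum.map_inl,
    Sum.map_inr, Sum.inl.injEq, Sum.inr.injEq, reduceCtorEq, if_false, sum_const_zero, add_zero,
    zero_add, Fintype.sum_prod_type]
  have h1 : ∀ {t : ℕ} (N : Fin t → Fin t → ℕ) (i : Fin t),
      ∑ x, ∑ y, (if x = i then N x y else 0) = ∑ y, N i y := fun N i => by
    rw [Finset.sum_comm]
    simp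
  simp only [h1 (fun x y => content E (Sum.inl (x, y))), h1 (fun x y => content E (Sum.inr (x, y))),
    Finset.sum_ite_eq', Finset.mem_univ, if_true]
  ring

lemma sum_stairProd {n r s : ℕ} {l : Fin r → ℕ} {m : Fin s → ℕ} (hl : Function.Injective l)
    (hm : Function.Injective m)
    (hn : ∑ i, l i + ∑ j, m j = n + ∑ i : Fin r, (i : ℕ) + ∑ j : Fin s, (j : ℕ)) :
    ∑ N ∈ Finset.piAntidiag (Finset.univ : Finset (Diag r s)) n, stairProd l m N = 1 := by
  classical
  set B := n + ∑ i, l i + ∑ j, m j + 1 with hB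
  have h1 : ∑ N : Diag r s → Fin B, stairProd l m (fun x => N x) = 1 := by
    rw [← Equiv.sum_comp (Equiv.sumArrowEquivProdArrow _ _ _).symm, Fintype.sum_prod_type]
    simp only [stairProd, Equiv.sumArrowEquivProdArrow_symm_apply_inl,
      Equiv.sumArrowEquivProdArrow_symm_apply_inr]
    rw [← Finset.sum_mul_sum, sum_stair_mul_stair l hl, sum_stair_mul_stair m hm, one_mul]
    · intro j
      have := Finset.single_le_sum (f := m) (fun _ _ => Nat.zero_le _) (Finset.mem_univ j)
      omega
    · intro i
      have := Finset.single_le_sum (f := l) (fun _ _ => Nat.zero_le _) (Finset.mem_univ i)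
      omega
  rw [← h1]
  have hle : ∀ N ∈ Finset.piAntidiag (Finset.univ : Finset (Diag r s)) n, ∀ x, N x < B :=
    fun N hN x => by
    have h2 : ∑ x, N x = n := by simpa using hN
    have h3 := Finset.single_le_sum (f := N) (fun _ _ => Nat.zero_le _) (Finset.mem_univ x)
    omega
  refine Finset.sum_bij_ne_zero (fun N hN _ x => ⟨N x, hle N hN x⟩) (fun _ _ _ => Finset.mem_univ _)
    (fun N _ _ N' _ _ h => funext fun x => congrArg Fin.val (congrFun h x)) ?_
    (fun _ _ _ => rfl)
  intro N _ hN
  refine ⟨fun x => N x, ?_, hN, rfl⟩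
  have h2 := stair_ne_zero (left_ne_zero_of_mul (left_ne_zero_of_mul hN))
  have h3 := stair_ne_zero (left_ne_zero_of_mul (right_ne_zero_of_mul hN))
  simp only [Finset.mem_piAntidiag, Finset.mem_univ, implies_true, and_true,
    Fintype.sum_sum_type, Fintype.sum_prod_type]
  dsimp only at h2 h3
  omega

lemma card_BWn (n : ℕ) : Nat.card (BWn n) = n.factorial * 2 ^ n := by
  rw [← Nat.card_congr (eqvBWn n)]
  simp [Fintype.card_perm]

lemma even_expo {r s : ℕ} (a b : Fin r ⊕ Fin s) :
    Even (expo a + expo b) ↔ ∃ x : Diag r s, diagFst x = a ∧ diagSnd x = b := by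
  rcases a with a | a <;> rcases b with b | b <;>
    simp [expo, diagFst, diagSnd, parity_simps]

/-- The Jacobi-Trudi combinations have norm one. -/
lemma cinner_self {n r s : ℕ} {l : Fin r → ℕ} {m : Fin s → ℕ} (hl : Function.Injective l)
    (hm : Function.Injective m)
    (hn : ∑ i, l i + ∑ j, m j = n + ∑ i : Fin r, (i : ℕ) + ∑ j : Fin s, (j : ℕ))
    {X : BWn n → ℂ} (hX : ∀ w, X w = ∑ f : Fin n → Fin r ⊕ Fin s,
      (stair₂ l m (content f) : ℂ) * diagCoeff (expo ∘ f) w) : cinner X X = 1 := by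
  classical
  have hinv : ∀ w, X w⁻¹ = X w := fun w => by simp only [hX, diagCoeff_inv]
  rw [cinner, finsum_congr fun w => by rw [hinv], ← finsum_comp_equiv (eqvBWn n),
    finsum_eq_sum_of_fintype, card_BWn]
  have h1 : ∑ x, X (eqvBWn n x) * X (eqvBWn n x) =
      ∑ p : (Fin n → Fin r ⊕ Fin s) × (Fin n → Fin r ⊕ Fin s),
        ((stair₂ l m (content p.1) : ℂ) * stair₂ l m (content p.2)) *
          ∑ x, diagCoeff (expo ∘ p.1) (eqvBWn n x) * diagCoeff (expo ∘ p.2) (eqvBWn n x) := by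
    simp only [hX, Finset.sum_mul_sum]
    simp only [Finset.mul_sum, Fintype.sum_prod_type (α₁ := Fin n → _)]
    rw [Finset.sum_comm]
    refine Finset.sum_congr rfl fun f _ => ?_
    rw [Finset.sum_comm]
    refine Finset.sum_congr rfl fun f' _ => Finset.sum_congr rfl fun x _ => ?_
    ring
  have h2 : ∑ E : Fin n → Diag r s, ((stairProd l m (content E) : ℂ) *
      (2 ^ n * ((Finset.univ.filter fun u : Perm (Fin n) => E ∘ u = E).card : ℂ))) =
      ∑ x, X (eqvBWn n x) * X (eqvBWn n x) := by
    rw [h1]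
    refine Fintype.sum_of_injective (fun E => (diagFst ∘ E, diagSnd ∘ E)) ?_ _ _ ?_ ?_
    · intro E E' h
      funext i
      have h3 := congrFun (congrArg Prod.fst h) i
      have h4 := congrFun (congrArg Prod.snd h) i
      revert h3 h4
      simp only [Function.comp_apply, diagFst, diagSnd]
      rcases E i with ⟨a, b⟩ | ⟨a, b⟩ <;> rcases E' i with ⟨a', b'⟩ | ⟨a', b'⟩ <;> simp <;> tauto
    · rintro ⟨f, f'⟩ hf
      rw [sum_diagCoeff_mul, if_neg, mul_zero]
      intro hev
      choose E hE1 hE2 using fun i => (even_expo (f i) (f' i)).1 (hev i)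
      exact hf ⟨E, Prod.ext (funext hE1) (funext hE2)⟩
    · intro E
      have hev : ∀ i, Even ((expo ∘ (diagFst ∘ E)) i + (expo ∘ (diagSnd ∘ E)) i) := fun i =>
        (even_expo _ _).2 ⟨E i, rfl, rfl⟩
      dsimp only
      rw [sum_diagCoeff_mul, if_pos hev]
      rw [← stair₂_mul_stair₂]
      push_cast
      congr 4
      ext u
      simp only [Finset.mem_filter, Finset.mem_univ, true_and, funext_iff, Function.comp_apply,
        expo_injective.eq_iff, ← forall_and]
      refine forall_congr' fun i => ?_
      simp only [diagFst, diagSnd]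
      rcases E i with ⟨a, b⟩ | ⟨a, b⟩ <;> rcases E (u i) with ⟨a', b'⟩ | ⟨a', b'⟩ <;> simp
  have h3 := sum_content_stabilizer (n := n) (fun N => (stairProd l m N : ℂ))
  rw [← Int.cast_sum, sum_stairProd hl hm hn] at h3
  have h4 : ∑ E : Fin n → Diag r s, ((stairProd l m (content E) : ℂ) *
      (2 ^ n * ((Finset.univ.filter fun u : Perm (Fin n) => E ∘ u = E).card : ℂ))) =
      2 ^ n * ∑ E : Fin n → Diag r s,
        (Finset.univ.filter fun u : Perm (Fin n) => E ∘ u = E).card •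
          (stairProd l m (content E) : ℂ) := by
    rw [Finset.mul_sum]
    refine Finset.sum_congr rfl fun E _ => ?_
    rw [nsmul_eq_mul]
    ring
  rw [← h2, h4, h3]
  have : (n.factorial : ℂ) ≠ 0 := by exact_mod_cast n.factorial_ne_zero
  push_cast
  simp only [nsmul_eq_mul]
  field_simp

/-- The number of indices in the block of `i` at which `g` is smaller than at `i`. -/
def blockRank {n : ℕ} (f g : Fin n → ℕ) (i : Fin n) : ℕ :=
  (Finset.univ.filter fun j => f j = f i ∧ g j < g i).card

/-- The functions `f` and `g` jointly separate points. -/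
def InjOnBlocks {n : ℕ} (f g : Fin n → ℕ) : Prop := ∀ i j, f i = f j → g i = g j → i = j

lemma blockRank_le {n : ℕ} {f g : Fin n → ℕ} (h : InjOnBlocks f g) (i : Fin n) :
    blockRank f g i ≤ g i := by
  rw [blockRank, ← Finset.card_range (g i)]
  refine Finset.card_le_card_of_injOn g (fun j hj => ?_) fun j hj k hk hjk => ?_
  · simpa using (Finset.mem_filter.1 hj).2.2
  · exact h j k ((Finset.mem_filter.1 hj).2.1.trans (Finset.mem_filter.1 hk).2.1.symm) hjk

lemma two_mul_sum_blockRank {n : ℕ} {f g : Fin n → ℕ} (h : InjOnBlocks f g) :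
    2 * ∑ i, blockRank f g i = ∑ i, (Finset.univ.filter fun j => f j = f i ∧ j ≠ i).card := by
  have h1 : ∀ i, (Finset.univ.filter fun j => f j = f i ∧ j ≠ i).card =
      blockRank f g i + (Finset.univ.filter fun j => f j = f i ∧ g i < g j).card := fun i => by
    rw [blockRank, ← Finset.card_union_of_disjoint
      (Finset.disjoint_filter.2 fun j _ h1 h2 => by omega), ← Finset.filter_or]
    congr 1
    ext j
    simp only [Finset.mem_filter, Finset.mem_univ, true_and, ← and_or_left, and_congr_right_iff]
    intro hf
    rw [← ne_iff_lt_or_gt]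
    exact not_congr ⟨fun hj => by rw [hj], fun hg => h _ _ hf hg⟩
  rw [Finset.sum_congr rfl fun i _ => h1 i, sum_add_distrib, two_mul]
  congr 1
  simp only [blockRank, Finset.card_filter]
  rw [Finset.sum_comm]
  simp only [eq_comm]

lemma blockRank_lt_of_lt {n : ℕ} {f g : Fin n → ℕ} {i j : Fin n} (hf : f i = f j)
    (hg : g i < g j) : blockRank f g i < blockRank f g j := by
  refine Finset.card_lt_card ⟨fun k hk => ?_, fun hs => ?_⟩
  · simp only [Finset.mem_filter, Finset.mem_univ, true_and] at hk ⊢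
    exact ⟨hk.1.trans hf, hk.2.trans hg⟩
  · have := hs (show i ∈ _ by simp [hf, hg])
    simp at this

lemma injOnBlocks_blockRank {n : ℕ} {f g : Fin n → ℕ} (h : InjOnBlocks f g) :
    InjOnBlocks f (blockRank f g) := fun i j hf hr => by
  rcases lt_trichotomy (g i) (g j) with hg | hg | hg
  · exact absurd hr (blockRank_lt_of_lt hf hg).ne
  · exact h i j hf hg
  · exact absurd hr (blockRank_lt_of_lt hf.symm hg).ne'

lemma content_blockRank {n : ℕ} {f g : Fin n → ℕ} (h : InjOnBlocks f g) (b t : ℕ) :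
    content (fun i => (f i, blockRank f g i)) (b, t) = if t < content f b then 1 else 0 := by
  have hinj : Set.InjOn (blockRank f g) (Finset.univ.filter fun i => f i = b : Finset (Fin n)) :=
    fun i hi j hj hr => injOnBlocks_blockRank h i j
      ((Finset.mem_filter.1 hi).2.trans (Finset.mem_filter.1 hj).2.symm) hr
  have himg : (Finset.univ.filter fun i => f i = b).image (blockRank f g) =
      Finset.range (content f b) := by
    refine Finset.eq_of_subset_of_card_le (fun x hx => ?_) ?_
    · obtain ⟨i, hi, rfl⟩ := Finset.mem_image.1 hx
      obtain rfl := (Finset.mem_filter.1 hi).2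
      rw [Finset.mem_range, blockRank, content]
      refine Finset.card_lt_card ⟨fun k hk => ?_, fun hs => ?_⟩
      · simp only [Finset.mem_filter, Finset.mem_univ, true_and] at hk ⊢
        exact hk.1
      · have := hs hi
        simp at this
    · rw [Finset.card_image_of_injOn hinj, Finset.card_range, content]
  split_ifs with ht
  · obtain ⟨i, hi, hr⟩ := Finset.mem_image.1 (himg ▸ Finset.mem_range.2 ht)
    refine Finset.card_eq_one.2 ⟨i, ?_⟩
    ext j
    simp only [Finset.mem_filter, Finset.mem_univ, true_and, Finset.mem_singleton, Prod.mk.injEq]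
    constructor
    · rintro ⟨h1, h2⟩
      exact hinj (by simpa using h1) hi (h2.trans hr.symm)
    · rintro rfl
      exact ⟨(Finset.mem_filter.1 hi).2, hr⟩
  · refine Finset.card_eq_zero.2 (Finset.filter_eq_empty_iff.2 fun i _ hi => ht ?_)
    rw [← Finset.mem_range, ← himg]
    exact Finset.mem_image.2 ⟨i, by simpa using congrArg Prod.fst hi, congrArg Prod.snd hi⟩

/-- The leading exponent vector of the product of the Vandermonde determinants of the blocks. -/
def vdmExp {n : ℕ} (f : Fin n → ℕ) : Fin n → ℕ := blockRank f fun i => i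

lemma injOnBlocks_val {n : ℕ} (f : Fin n → ℕ) : InjOnBlocks f fun i => (i : ℕ) :=
  fun _ _ _ h => Fin.ext h

lemma exists_perm_eq_vdmExp {n : ℕ} {f e : Fin n → ℕ} (h : InjOnBlocks f e)
    (he : ∑ i, e i ≤ ∑ i, vdmExp f i) :
    ∃ u : Perm (Fin n), (∀ i, f (u i) = f i) ∧ e = vdmExp f ∘ u := by
  have hs : ∑ i, blockRank f e i = ∑ i, vdmExp f i := by
    have h1 := two_mul_sum_blockRank h
    have h2 := two_mul_sum_blockRank (injOnBlocks_val f)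
    rw [vdmExp]
    omega
  have heq : blockRank f e = e := by
    have hle : ∀ i ∈ Finset.univ, blockRank f e i ≤ e i := fun i _ => blockRank_le h i
    funext i
    exact (Finset.sum_eq_sum_iff_of_le hle).1
      (le_antisymm (Finset.sum_le_sum hle) (he.trans hs.ge)) i (Finset.mem_univ i)
  obtain ⟨u, hu⟩ := exists_perm_of_content_eq
    (f := fun i => (f i, vdmExp f i)) (g := fun i => (f i, blockRank f e i)) (by
      funext ⟨b, t⟩
      rw [content_blockRank h, vdmExp, content_blockRank (injOnBlocks_val f)])
  refine ⟨u, fun i => (congrArg Prod.fst (congrFun hu i)).symm, ?_⟩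
  rw [← heq]
  funext i
  exact congrArg Prod.snd (congrFun hu i)

lemma content_vdmExp {n : ℕ} {f : Fin n → ℕ} {S : Finset ℕ} (hS : ∀ i, f i ∈ S) (t : ℕ) :
    content (vdmExp f) t = (S.filter fun b => t < content f b).card := by
  rw [Finset.card_filter]
  simp only [← content_blockRank (injOnBlocks_val f)]
  rw [content, Finset.card_eq_sum_card_fiberwise (f := f) (t := S) (fun i _ => hS i)]
  refine Finset.sum_congr rfl fun b _ => ?_
  rw [content, Finset.filter_filter]
  congr 1
  ext i
  simp [vdmExp, and_comm]

/-- The element of the hyperoctahedral group given by a permutation with trivial signs. -/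
def emb {n : ℕ} (u : Perm (Fin n)) : BWn n := eqvBWn n (u, fun _ => false)

@[simp] lemma pp_emb {n : ℕ} (u : Perm (Fin n)) : pp (emb u) = u := by simp [emb]

@[simp] lemma sg_emb {n : ℕ} (u : Perm (Fin n)) (i : Fin n) : sg (emb u) i = 1 := by simp [emb]

/-- A vector on which the permutations preserving the blocks of `f` act by their signs. -/
def IsAlt {n : ℕ} {V : Type*} [AddCommGroup V] [Module ℂ V] (f : Fin n → ℕ)
    (ρ : Representation ℂ (BWn n) V) (v : V) : Prop :=
  ∀ u : Perm (Fin n), (∀ i, f (u i) = f i) → ρ (emb u) v = ((Perm.sign u : ℤ) : ℂ) • v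

lemma monoRep_emb {n : ℕ} {Y : Finset (Fin n → ℕ)} (hY : PermStable Y) (u : Perm (Fin n))
    (v : EuclideanSpace ℂ Y) (e : Y) :
    monoRep Y hY (emb u) v e = v ⟨e.1 ∘ u, hY _ e.2 u⟩ := by
  rw [monoRep_apply]
  simp

lemma IsAlt.eq_zero {n : ℕ} {f : Fin n → ℕ} {Y : Finset (Fin n → ℕ)} {hY : PermStable Y}
    {v : EuclideanSpace ℂ Y} (hv : IsAlt f (monoRep Y hY) v)
    (hdeg : ∀ e ∈ Y, ∑ i, e i ≤ ∑ i, vdmExp f i) (h0 : ∀ h : vdmExp f ∈ Y, v ⟨_, h⟩ = 0) :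
    v = 0 := by
  have hv' : ∀ u : Perm (Fin n), (∀ i, f (u i) = f i) → ∀ e : Y,
      v ⟨e.1 ∘ u, hY _ e.2 u⟩ = ((Perm.sign u : ℤ) : ℂ) * v e := fun u hu e => by
    rw [← monoRep_emb, hv u hu]
    rfl
  ext ⟨e, he⟩
  by_cases hinj : InjOnBlocks f e
  · obtain ⟨u, hu, rfl⟩ := exists_perm_eq_vdmExp hinj (hdeg e he)
    have h1 : vdmExp f ∈ Y := by
      have := hY _ he u⁻¹
      rwa [show (vdmExp f ∘ u) ∘ (u⁻¹ : Perm (Fin n)) = vdmExp f by funext i; simp] at this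
    have := hv' u hu ⟨_, h1⟩
    rw [h0 h1, mul_zero] at this
    exact this
  · simp only [InjOnBlocks, not_forall] at hinj
    obtain ⟨i, j, hf, hij, hne⟩ := hinj
    have h1 := hv' (swap i j) (apply_swap_eq f hf) ⟨e, he⟩
    have h2 : e ∘ swap i j = e := funext (apply_swap_eq e hij)
    simp only [h2, Perm.sign_swap hne] at h1
    push_cast at h1
    have h3 : v ⟨e, he⟩ = 0 := by linear_combination h1 / 2
    exact h3

/-- The product of the Vandermonde determinants of the blocks of `f`. -/
def vdm {n : ℕ} (f : Fin n → ℕ) : EuclideanSpace ℂ (degExp n (∑ i, vdmExp f i)) :=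
  WithLp.toLp 2 fun e => ∑ u : Perm (Fin n),
    if (∀ i, f (u i) = f i) ∧ e.1 = vdmExp f ∘ u then ((Perm.sign u : ℤ) : ℂ) else 0

lemma isAlt_vdm {n : ℕ} (f : Fin n → ℕ) :
    IsAlt f (monoRep _ (permStable_degExp n _)) (vdm f) := fun w hw => by
  ext e
  rw [monoRep_emb]
  simp only [vdm, PiLp.smul_apply, smul_eq_mul, Finset.mul_sum]
  rw [← Equiv.sum_comp (Equiv.mulRight w)]
  refine Finset.sum_congr rfl fun u _ => ?_
  have h1 : (∀ i, f ((u * w) i) = f i) ↔ ∀ i, f (u i) = f i := by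
    refine ⟨fun h i => ?_, fun h i => by rw [Perm.mul_apply, h, hw]⟩
    have := h (w⁻¹ i)
    rwa [apply_inv_eq hw, Perm.mul_apply, show w (w⁻¹ i) = i by simp] at this
  have h2 : e.1 ∘ w = vdmExp f ∘ (u * w : Perm (Fin n)) ↔ e.1 = vdmExp f ∘ u := by
    rw [Perm.coe_mul, ← Function.comp_assoc]
    exact w.surjective.right_cancellable
  simp only [Equiv.coe_mulRight, h1, h2, Perm.sign_mul, Units.val_mul, Int.cast_mul]
  split_ifs <;> ring

lemma vdm_vdmExp {n : ℕ} (f : Fin n → ℕ) (h : vdmExp f ∈ degExp n (∑ i, vdmExp f i)) :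
    vdm f ⟨_, h⟩ = 1 := by
  simp only [vdm]
  rw [Finset.sum_eq_single 1]
  · simp
  · rintro u - hu
    refine if_neg fun ⟨h1, h2⟩ => hu (Equiv.ext fun i => ?_)
    exact injOnBlocks_blockRank (injOnBlocks_val f) _ _ (h1 i) (congrFun h2 i).symm
  · simp

lemma cinner_eq {G : Type} [Group G] [Fintype G] (φ ψ : G → ℂ) :
    cinner φ ψ = (Nat.card G : ℂ)⁻¹ * ∑ g, φ g * ψ g⁻¹ := by
  rw [cinner, finsum_eq_sum_of_fintype]

lemma cinner_comm {G : Type} [Group G] [Finite G] (φ ψ : G → ℂ) : cinner φ ψ = cinner ψ φ := by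
  have := Fintype.ofFinite G
  rw [cinner_eq, cinner_eq, ← Equiv.sum_comp (Equiv.inv G)]
  simp [mul_comm]

lemma cinner_sum_right {G ι : Type} [Group G] [Finite G] (φ : G → ℂ) (S : Finset ι) (a : ι → ℂ)
    (ψ : ι → G → ℂ) :
    cinner φ (fun g => ∑ c ∈ S, a c * ψ c g) = ∑ c ∈ S, a c * cinner φ (ψ c) := by
  have := Fintype.ofFinite G
  simp only [cinner_eq, Finset.mul_sum]
  rw [Finset.sum_comm]
  refine Finset.sum_congr rfl fun c _ => Finset.sum_congr rfl fun g _ => by ring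

lemma cinner_character {G V W : Type} [Group G] [Finite G] [AddCommGroup V] [Module ℂ V]
    [FiniteDimensional ℂ V] [AddCommGroup W] [Module ℂ W] [FiniteDimensional ℂ W]
    (ρ : Representation ℂ G V) (σ : Representation ℂ G W) :
    cinner ρ.character σ.character = Module.finrank ℂ (ρ.IntertwiningMap σ) := by
  have := Fintype.ofFinite G
  have : Invertible (Nat.card G : ℂ) :=
    invertibleOfNonzero (Nat.cast_ne_zero.2 Nat.card_pos.ne')
  rw [← Representation.card_inv_mul_sum_char_mul_char_eq_finrank, cinner_comm, cinner_eq]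

/-- Two characters of norm one and inner product one coincide. -/
lemma eq_of_cinner_eq_one {G : Type} [Group G] [Finite G] {φ ψ : G → ℂ}
    (hφ : ∀ g, φ g⁻¹ = starRingEnd ℂ (φ g)) (hψ : ∀ g, ψ g⁻¹ = starRingEnd ℂ (ψ g))
    (h1 : cinner φ φ = 1) (h2 : cinner ψ ψ = 1) (h3 : cinner φ ψ = 1) : φ = ψ := by
  have := Fintype.ofFinite G
  have h4 := h3
  rw [cinner_comm] at h4
  rw [cinner_eq] at h1 h2 h3 h4
  have hD : (Nat.card G : ℂ)⁻¹ * ∑ g, (φ g - ψ g) * (φ g⁻¹ - ψ g⁻¹) = 0 := by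
    have : ∀ g, (φ g - ψ g) * (φ g⁻¹ - ψ g⁻¹) =
        φ g * φ g⁻¹ - φ g * ψ g⁻¹ - (ψ g * φ g⁻¹ - ψ g * ψ g⁻¹) := fun g => by ring
    simp only [this, sum_sub_distrib, mul_sub, h1, h2, h3, h4]
    norm_num
  have hc : (Nat.card G : ℂ)⁻¹ ≠ 0 := inv_ne_zero (Nat.cast_ne_zero.2 Nat.card_pos.ne')
  replace hD := (mul_eq_zero.1 hD).resolve_left hc
  have hD' : ∑ g, Complex.normSq (φ g - ψ g) = 0 := by
    have : ∀ g, (φ g - ψ g) * (φ g⁻¹ - ψ g⁻¹) = (Complex.normSq (φ g - ψ g) : ℂ) := fun g => by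
      rw [hφ, hψ, ← map_sub, Complex.mul_conj]
    simp only [this] at hD
    exact_mod_cast hD
  rw [Finset.sum_eq_zero_iff_of_nonneg fun _ _ => Complex.normSq_nonneg _] at hD'
  funext g
  exact sub_eq_zero.1 (Complex.normSq_eq_zero.1 (hD' g (Finset.mem_univ g)))

/-- The subrepresentation generated by the product of the Vandermonde determinants of the
blocks of `f`. -/
def vdmSub {n : ℕ} (f : Fin n → ℕ) :
    Subrepresentation (monoRep _ (permStable_degExp n (∑ i, vdmExp f i))) where
  toSubmodule := Submodule.span ℂ (Set.range fun w => monoRep _ (permStable_degExp n _) w (vdm f))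
  apply_mem_toSubmodule g v hv := by
    induction hv using Submodule.span_induction with
    | mem x hx =>
      obtain ⟨w, rfl⟩ := hx
      refine Submodule.subset_span ⟨g * w, ?_⟩
      simp only [map_mul, Module.End.mul_apply]
    | zero => simp
    | add x y _ _ hx hy => rw [map_add]; exact Submodule.add_mem _ hx hy
    | smul c x _ hx => rw [map_smul]; exact Submodule.smul_mem _ c hx

/-- The irreducible representation of the hyperoctahedral group generated by the product of the
Vandermonde determinants of the blocks of `f`. -/
abbrev vdmRep {n : ℕ} (f : Fin n → ℕ) :
    Representation ℂ (BWn n) (vdmSub f).toSubmodule := (vdmSub f).toRepresentation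

/-- The generator of `vdmRep f`. -/
def vdmGen {n : ℕ} (f : Fin n → ℕ) : (vdmSub f).toSubmodule :=
  ⟨vdm f, Submodule.subset_span ⟨1, by simp⟩⟩

lemma isAlt_vdmGen {n : ℕ} (f : Fin n → ℕ) : IsAlt f (vdmRep f) (vdmGen f) :=
  fun u hu => Subtype.ext (isAlt_vdm f u hu)

lemma vdmRep_hom_ext {n : ℕ} {f : Fin n → ℕ} {W : Type} [AddCommGroup W] [Module ℂ W]
    {σ : Representation ℂ (BWn n) W} {φ ψ : (vdmRep f).IntertwiningMap σ}
    (h : φ (vdmGen f) = ψ (vdmGen f)) : φ = ψ := by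
  refine Representation.IntertwiningMap.ext (LinearMap.ext fun ⟨v, hv⟩ => ?_)
  change φ ⟨v, hv⟩ = ψ ⟨v, hv⟩
  induction hv using Submodule.span_induction with
  | mem x hx =>
    obtain ⟨w, rfl⟩ := hx
    have h1 := Representation.IntertwiningMap.isIntertwining _ _ φ w (vdmGen f)
    have h2 := Representation.IntertwiningMap.isIntertwining _ _ ψ w (vdmGen f)
    exact h1.trans ((congrArg _ h).trans h2.symm)
  | zero => exact (map_zero φ).trans (map_zero ψ).symm
  | add x y hx' hy' hx hy =>
    have h1 := map_add φ ⟨x, hx'⟩ ⟨y, hy'⟩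
    have h2 := map_add ψ ⟨x, hx'⟩ ⟨y, hy'⟩
    rw [hx, hy] at h1
    exact h1.trans h2.symm
  | smul c x hx' hx =>
    have h1 := map_smul φ c ⟨x, hx'⟩
    have h2 := map_smul ψ c ⟨x, hx'⟩
    rw [hx] at h1
    exact h1.trans h2.symm

lemma IsAlt.map {n : ℕ} {f : Fin n → ℕ} {V W : Type} [AddCommGroup V] [Module ℂ V]
    [AddCommGroup W] [Module ℂ W] {ρ : Representation ℂ (BWn n) V}
    {σ : Representation ℂ (BWn n) W} {v : V} (h : IsAlt f ρ v) (φ : ρ.IntertwiningMap σ) :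
    IsAlt f σ (φ v) := fun u hu => by
  rw [← Representation.IntertwiningMap.isIntertwining _ _ φ, h u hu, map_smul]

lemma finrank_vdmRep_hom_eq_zero {n : ℕ} {f : Fin n → ℕ} {Y : Finset (Fin n → ℕ)}
    (hY : PermStable Y) (hdeg : ∀ e ∈ Y, ∑ i, e i ≤ ∑ i, vdmExp f i) (hmem : vdmExp f ∉ Y) :
    Module.finrank ℂ ((vdmRep f).IntertwiningMap (monoRep Y hY)) = 0 := by
  have : Subsingleton ((vdmRep f).IntertwiningMap (monoRep Y hY)) := ⟨fun φ ψ => by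
    refine vdmRep_hom_ext ?_
    rw [((isAlt_vdmGen f).map φ).eq_zero hdeg fun h => absurd h hmem,
      ((isAlt_vdmGen f).map ψ).eq_zero hdeg fun h => absurd h hmem]⟩
  exact Module.finrank_zero_of_subsingleton

/-- The projection from the generated representation to a span of monomials. -/
def vdmProj {n : ℕ} (f : Fin n → ℕ) {Y : Finset (Fin n → ℕ)} (hY : PermStable Y)
    (hsub : Y ⊆ degExp n (∑ i, vdmExp f i)) : (vdmRep f).IntertwiningMap (monoRep Y hY) :=
  LinearMap.intertwiningMap_of_isIntertwiningMap (vdmRep f) (monoRep Y hY)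
    (f :=
      { toFun := fun v => WithLp.toLp 2 fun e => v.1 ⟨e.1, hsub e.2⟩
        map_add' := fun _ _ => rfl
        map_smul' := fun _ _ => rfl }) fun _ _ => rfl

lemma finrank_vdmRep_hom_eq_one {n : ℕ} {f : Fin n → ℕ} {Y : Finset (Fin n → ℕ)}
    (hY : PermStable Y) (hsub : Y ⊆ degExp n (∑ i, vdmExp f i)) (hmem : vdmExp f ∈ Y) :
    Module.finrank ℂ ((vdmRep f).IntertwiningMap (monoRep Y hY)) = 1 := by
  have h1 : vdmProj f hY hsub (vdmGen f) ⟨_, hmem⟩ = 1 := vdm_vdmExp f (hsub hmem)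
  refine (finrank_eq_one_iff_of_nonzero' (vdmProj f hY hsub) fun h => ?_).2 fun φ => ?_
  · rw [h] at h1
    exact zero_ne_one h1
  · refine ⟨φ (vdmGen f) ⟨_, hmem⟩, vdmRep_hom_ext (sub_eq_zero.1 ?_)⟩
    have hA := (isAlt_vdmGen f).map (φ (vdmGen f) ⟨_, hmem⟩ • vdmProj f hY hsub - φ)
    refine hA.eq_zero (fun e he => (mem_degExp.1 (hsub he)).le) fun _ => ?_
    change φ (vdmGen f) ⟨_, hmem⟩ * vdmProj f hY hsub (vdmGen f) ⟨_, hmem⟩ - φ (vdmGen f) ⟨_, hmem⟩ = 0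
    rw [h1, mul_one, sub_self]

lemma finrank_vdmRep_end {n : ℕ} (f : Fin n → ℕ) :
    Module.finrank ℂ ((vdmRep f).IntertwiningMap (vdmRep f)) = 1 := by
  have hmem : vdmExp f ∈ degExp n (∑ i, vdmExp f i) := by simp
  have h1 := vdm_vdmExp f hmem
  refine (finrank_eq_one_iff_of_nonzero' (Representation.IntertwiningMap.id (vdmRep f))
    fun h => ?_).2 fun φ => ?_
  · have h2 : vdm f = 0 := congrArg (fun φ : (vdmRep f).IntertwiningMap (vdmRep f) =>
      (φ (vdmGen f)).1) h
    rw [h2] at h1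
    exact zero_ne_one h1
  · refine ⟨(φ (vdmGen f)).1 ⟨_, hmem⟩, vdmRep_hom_ext (sub_eq_zero.1 (Subtype.ext ?_))⟩
    have hA := (isAlt_vdmGen f).map ((φ (vdmGen f)).1 ⟨_, hmem⟩ •
      Representation.IntertwiningMap.id (vdmRep f) - φ)
    refine IsAlt.eq_zero (f := f) (hY := permStable_degExp n _)
      (fun u hu => congrArg Subtype.val (hA u hu)) (fun e he => (mem_degExp.1 he).le) fun _ => ?_
    change (φ (vdmGen f)).1 ⟨_, hmem⟩ * vdm f ⟨_, hmem⟩ - (φ (vdmGen f)).1 ⟨_, hmem⟩ = 0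
    rw [h1, mul_one, sub_self]

lemma character_vdmRep_inv {n : ℕ} (f : Fin n → ℕ) (w : BWn n) :
    (vdmRep f).character w⁻¹ = starRingEnd ℂ ((vdmRep f).character w) := by
  have b := stdOrthonormalBasis ℂ (vdmSub f).toSubmodule
  rw [Representation.character, LinearMap.trace_eq_sum_inner _ b, Representation.character,
    LinearMap.trace_eq_sum_inner _ b, map_sum]
  refine Finset.sum_congr rfl fun i _ => ?_
  rw [inner_conj_symm, Submodule.coe_inner, Submodule.coe_inner]
  change inner ℂ (b i).1 (monoRep _ (permStable_degExp n _) w⁻¹ (b i).1) =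
    inner ℂ (monoRep _ (permStable_degExp n _) w (b i).1) (b i).1
  rw [← inner_monoRep _ (permStable_degExp n _) w]
  congr 1
  rw [← Module.End.mul_apply, ← map_mul, mul_inv_cancel, map_one, Module.End.one_apply]

lemma conj_diagCoeff {n : ℕ} (e : Fin n → ℕ) (w : BWn n) :
    starRingEnd ℂ (diagCoeff e w) = diagCoeff e w := by
  have hs : ∀ i, starRingEnd ℂ (sg w i) = sg w i := fun i => by
    rcases sg_eq w i with h | h <;> simp [h]
  unfold diagCoeff
  split_ifs <;> simp [hs]

/-- The exponent vectors coming from colourings with prescribed multiplicities. -/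
def expoSet (n : ℕ) {r s : ℕ} (c : Fin r ⊕ Fin s → ℕ) : Finset (Fin n → ℕ) :=
  (Finset.univ.filter fun g : Fin n → Fin r ⊕ Fin s => content g = c).image (expo ∘ ·)

lemma mem_expoSet {n r s : ℕ} {c : Fin r ⊕ Fin s → ℕ} {e : Fin n → ℕ} :
    e ∈ expoSet n c ↔ ∃ g : Fin n → Fin r ⊕ Fin s, content g = c ∧ expo ∘ g = e := by
  simp [expoSet]

lemma permStable_expoSet (n : ℕ) {r s : ℕ} (c : Fin r ⊕ Fin s → ℕ) :
    PermStable (expoSet n c) := fun e he u => by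
  obtain ⟨g, hg, rfl⟩ := mem_expoSet.1 he
  exact mem_expoSet.2 ⟨g ∘ u, by rw [content_comp, hg], rfl⟩

lemma character_expoSet {n r s : ℕ} (c : Fin r ⊕ Fin s → ℕ) (w : BWn n) :
    (monoRep _ (permStable_expoSet n c)).character w =
      ∑ g with content g = c, diagCoeff (expo ∘ g) w := by
  rw [character_monoRep, expoSet, Finset.sum_image]
  exact fun g _ g' _ h => expo_injective.comp_left h

lemma sum_expo_comp {n r s : ℕ} (g : Fin n → Fin r ⊕ Fin s) :
    ∑ i, (expo ∘ g) i = 2 * ∑ i : Fin r, i * content g (Sum.inl i) +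
      (2 * ∑ j : Fin s, j * content g (Sum.inr j) + ∑ j, content g (Sum.inr j)) := by
  have h := sum_comp_eq_sum_content g Finset.univ (fun _ => Finset.mem_univ _) expo
  rw [Fintype.sum_sum_type] at h
  simp only [Function.comp_apply]
  rw [h, Finset.mul_sum, Finset.mul_sum, ← sum_add_distrib]
  congr 1 <;> refine Finset.sum_congr rfl fun x _ => ?_ <;> simp only [expo, Sum.elim_inl,
    Sum.elim_inr] <;> ring

lemma stair_support {r : ℕ} {l c a : Fin r → ℕ} (hl : ∀ i, l i = a i + i.rev)
    (h : stair l c ≠ 0) :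
    c = a ∨ ∑ i : Fin r, i * c i < ∑ i : Fin r, i * a i := by
  obtain ⟨σ, -, hσ⟩ := Finset.exists_ne_zero_of_sum_ne_zero h
  have hc : ∀ i, c i + ((σ i).rev : ℕ) = a i + i.rev := fun i => by
    by_contra h'
    exact hσ (by rw [if_neg fun h'' => h' ((congrFun h'' i).trans (hl i)), mul_zero])
  have hc' : ∀ i, (c i : ℤ) = a i + (σ i : ℕ) - (i : ℕ) := fun i => by
    have h1 := hc i
    rw [Fin.val_rev, Fin.val_rev] at h1
    have h2 := i.isLt
    have h3 := (σ i).isLt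
    omega
  have key : 2 * (∑ i : Fin r, ((i : ℕ) : ℤ) * a i - ∑ i : Fin r, ((i : ℕ) : ℤ) * c i) =
      ∑ i : Fin r, (((σ i : ℕ) : ℤ) - (i : ℕ)) ^ 2 := by
    have h1 : ∑ i : Fin r, (((σ i : ℕ) : ℤ)) ^ 2 = ∑ i : Fin r, ((i : ℕ) : ℤ) ^ 2 :=
      Equiv.sum_comp σ fun i : Fin r => ((i : ℕ) : ℤ) ^ 2
    have h2 : ∀ i : Fin r, (((σ i : ℕ) : ℤ) - (i : ℕ)) ^ 2 = ((σ i : ℕ) : ℤ) ^ 2 -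
        ((i : ℕ) : ℤ) ^ 2 + 2 * (((i : ℕ) : ℤ) * a i - ((i : ℕ) : ℤ) * c i) := fun i => by
      rw [hc' i]; ring
    simp only [h2, sum_add_distrib, sum_sub_distrib, h1, ← mul_sum]
    ring
  by_cases hz : ∀ i, σ i = i
  · left
    funext i
    have := hc i
    rw [hz i] at this
    omega
  · right
    obtain ⟨i, hi⟩ := not_forall.1 hz
    have hpos : 0 < ∑ i : Fin r, (((σ i : ℕ) : ℤ) - (i : ℕ)) ^ 2 := by
      refine Finset.sum_pos' (fun _ _ => sq_nonneg _) ⟨i, Finset.mem_univ _, ?_⟩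
      refine sq_pos_of_ne_zero (sub_ne_zero.2 fun h => hi (Fin.ext ?_))
      exact_mod_cast h
    zify
    linarith

lemma stair_self {r : ℕ} {l a : Fin r → ℕ} (hl : ∀ i, l i = a i + i.rev) : stair l a = 1 := by
  rw [stair, Finset.sum_eq_single 1]
  · simp [funext hl]
  · intro σ _ hσ
    rw [if_neg fun h => hσ (Equiv.ext fun i => ?_), mul_zero]
    have := congrFun h i
    rw [hl] at this
    exact Fin.rev_injective (Fin.ext (Nat.add_left_cancel this))
  · simp

lemma sum_rev (r : ℕ) : ∑ i : Fin r, (i.rev : ℕ) = ∑ i : Fin r, (i : ℕ) :=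
  Equiv.sum_comp Fin.revPerm fun i : Fin r => (i : ℕ)

/-- The Jacobi-Trudi type formula gives the character of the representation generated by the
product of Vandermonde determinants. -/
lemma chiB_eq_character {n r s : ℕ} {f : Fin n → ℕ} {g : Fin n → Fin r ⊕ Fin s}
    (hg : vdmExp f = expo ∘ g)
    (hl : Function.Injective fun i => content g (Sum.inl i) + (i.rev : ℕ))
    (hm : Function.Injective fun j => content g (Sum.inr j) + (j.rev : ℕ)) :
    chiB n r s (fun i => content g (Sum.inl i)) (fun j => content g (Sum.inr j)) =
      (vdmRep f).character := by
  set l : Fin r → ℕ := fun i => content g (Sum.inl i) + (i.rev : ℕ)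
  set m : Fin s → ℕ := fun j => content g (Sum.inr j) + (j.rev : ℕ)
  set X := chiB n r s (fun i => content g (Sum.inl i)) (fun j => content g (Sum.inr j))
  have hX : ∀ w, X w = ∑ h : Fin n → Fin r ⊕ Fin s,
      (stair₂ l m (content h) : ℂ) * diagCoeff (expo ∘ h) w :=
    chiB_eq (fun i => by simp [l]) (fun j => by simp [m])
  have hn : ∑ i, l i + ∑ j, m j = n + ∑ i : Fin r, (i : ℕ) + ∑ j : Fin s, (j : ℕ) := by
    have h1 := sum_content g
    rw [Fintype.sum_sum_type] at h1
    simp only [l, m, sum_add_distrib]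
    rw [sum_rev, sum_rev]
    omega
  have hX' : X = fun w => ∑ c ∈ Finset.piAntidiag Finset.univ n, (stair₂ l m c : ℂ) *
      (monoRep _ (permStable_expoSet n c)).character w := by
    funext w
    rw [hX, ← Finset.sum_fiberwise_of_maps_to (g := content)
      (t := Finset.piAntidiag Finset.univ n) (fun h _ => by simp [sum_content])]
    refine Finset.sum_congr rfl fun c _ => ?_
    rw [character_expoSet, Finset.mul_sum]
    refine Finset.sum_congr rfl fun h hh => ?_
    rw [(Finset.mem_filter.1 hh).2]
  have hdeg := sum_expo_comp g
  rw [← hg] at hdeg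
  have h3 : cinner (vdmRep f).character X = 1 := by
    rw [hX', cinner_sum_right, Finset.sum_eq_single (content g)]
    · rw [cinner_character, finrank_vdmRep_hom_eq_one]
      · simp [stair₂, stair_self (l := l) (fun _ => rfl), stair_self (l := m) (fun _ => rfl)]
      · intro e he
        obtain ⟨h, hh, rfl⟩ := mem_expoSet.1 he
        rw [mem_degExp, sum_expo_comp, hh, hdeg]
      · exact mem_expoSet.2 ⟨g, rfl, hg.symm⟩
    · intro c _ hc
      by_cases hs : stair₂ l m c = 0
      · simp [hs]
      rw [stair₂, mul_eq_zero, not_or] at hs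
      have hsum : ∑ j, c (Sum.inr j) = ∑ j, content g (Sum.inr j) := by
        have h1 := stair_ne_zero hs.2
        simp only [m, sum_add_distrib] at h1
        rw [sum_rev] at h1
        omega
      have hlt : ∀ e ∈ expoSet n c, ∑ i, e i < ∑ i, vdmExp f i := fun e he => by
        obtain ⟨h, rfl, rfl⟩ := mem_expoSet.1 he
        rw [sum_expo_comp, hdeg]
        rcases stair_support (l := l) (fun _ => rfl) hs.1 with h1 | h1 <;>
          rcases stair_support (l := m) (fun _ => rfl) hs.2 with h2 | h2
        · refine absurd (funext fun x => ?_) hc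
          rcases x with x | x
          exacts [congrFun h1 x, congrFun h2 x]
        · simp only [congrFun h1]
          omega
        · simp only [congrFun h2]
          omega
        · omega
      rw [cinner_character, finrank_vdmRep_hom_eq_zero _ (fun e he => (hlt e he).le)
        fun h => (hlt _ h).false]
      simp
    · simp [sum_content]
  refine eq_of_cinner_eq_one (fun w => ?_) (character_vdmRep_inv f) (cinner_self hl hm hn hX)
    (by rw [cinner_character, finrank_vdmRep_end, Nat.cast_one]) (by rw [cinner_comm, h3])
  simp only [hX, diagCoeff_inv, map_sum, map_mul, map_intCast, conj_diagCoeff]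

lemma cinner_indChar {G : Type} [Group G] {H K : Subgroup G} [Finite K] (hle : H ≤ K)
    {χ : K → ℂ} (hχ : ∀ x g, χ (x * g * x⁻¹) = χ g) (φ : H → ℂ) :
    cinner χ (indChar H K φ) = cinner (fun h => χ (Subgroup.inclusion hle h)) φ := by
  classical
  have hinj := Subgroup.inclusion_injective hle
  have : Finite H := Finite.of_injective _ hinj
  have := Fintype.ofFinite H
  have := Fintype.ofFinite K
  let F : K → ℂ := fun k => if h : (k : G) ∈ H then φ ⟨_, h⟩ else 0
  have h1 : ∀ g, indChar H K φ g = (Nat.card H : ℂ)⁻¹ * ∑ x : K, F (x * g * x⁻¹) := fun g => by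
    rw [indChar, finsum_eq_sum_of_fintype]
    congr 1
  have h2 : ∀ x : K, ∑ g, χ g * F (x * g⁻¹ * x⁻¹) = ∑ g, χ g * F g⁻¹ := fun x => by
    rw [← Equiv.sum_comp (MulAut.conj x).toEquiv fun g => χ g * F g⁻¹]
    refine Finset.sum_congr rfl fun g _ => ?_
    change _ = χ (x * g * x⁻¹) * F (x * g * x⁻¹)⁻¹
    rw [hχ, mul_inv_rev, mul_inv_rev, inv_inv, mul_assoc]
  have h3 : ∑ h : H, χ (Subgroup.inclusion hle h) * φ h⁻¹ = ∑ g, χ g * F g⁻¹ := by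
    refine Fintype.sum_of_injective _ hinj _ _ (fun g hg => ?_) fun h => ?_
    · rw [show F g⁻¹ = 0 from dif_neg fun h => hg ⟨⟨g, ?_⟩, rfl⟩, mul_zero]
      simpa using h
    · rw [show F (Subgroup.inclusion hle h)⁻¹ = φ h⁻¹ from dif_pos (h⁻¹).2]
  rw [cinner_eq, cinner_eq, h3]
  simp only [h1, mul_left_comm _ (Nat.card H : ℂ)⁻¹, ← Finset.mul_sum]
  simp only [Finset.mul_sum (s := (Finset.univ : Finset K)) (f := fun x => F _)]
  rw [Finset.sum_comm]
  simp only [h2, Finset.sum_const, Finset.card_univ, nsmul_eq_mul, Nat.card_eq_fintype_card]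
  have : (Fintype.card K : ℂ) ≠ 0 := Nat.cast_ne_zero.2 Fintype.card_ne_zero
  field_simp

lemma symChar_inclusion {G : Type} [Group G] {H K : Subgroup G} (hle : H ≤ K) (χ : G → ℂ)
    (d : ℕ) (h : H) :
    symChar (resChar H χ) d h = symChar (resChar K χ) d (Subgroup.inclusion hle h) := by
  induction d using Nat.strong_induction_on with
  | _ d ih =>
    cases d with
    | zero => rw [symChar, symChar]
    | succ d =>
      rw [symChar, symChar]
      congr 1
      refine Finset.sum_congr rfl fun k _ => ?_
      rw [ih (d - k) (by omega)]
      rfl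

lemma blkSub_S_le {n : ℕ} (f : Fin n → ℕ) : blkSub n f (fun _ => BTy.S) ≤ BWn n := fun y hy => by
  obtain ⟨u, -, h⟩ := (mem_blkSub_S _ _).1 hy
  exact (mem_BWn _).2 ⟨u, _, h⟩

/-- The inclusion of a product of symmetric groups into the hyperoctahedral group. -/
abbrev blkIncl {n : ℕ} (f : Fin n → ℕ) : blkSub n f (fun _ => BTy.S) →* BWn n :=
  Subgroup.inclusion (blkSub_S_le f)

lemma exists_blkIncl_eq {n : ℕ} {f : Fin n → ℕ} (h : blkSub n f (fun _ => BTy.S)) :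
    ∃ u : Perm (Fin n), (∀ i, f (u i) = f i) ∧ blkIncl f h = emb u := by
  obtain ⟨u, hu, h'⟩ := (mem_blkSub_S _ _).1 h.2
  exact ⟨u, hu, Subtype.ext h'⟩

lemma sgnChar_emb {n : ℕ} (u : Perm (Fin n)) : sgnChar (emb u : PG n) = (Perm.sign u : ℤ) := by
  have : Mrefl (emb u : PG n) = (u.permMatrix ℂ).transpose := by
    ext j i
    rw [Mrefl, Matrix.of_apply, apply_inl]
    simp [Equiv.Perm.permMatrix, PEquiv.toMatrix_apply, eq_comm]
  rw [sgnChar, this, Matrix.det_transpose, Matrix.det_permutation]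

/-- The sign representation of a product of symmetric groups. -/
def sgnRep {n : ℕ} (f : Fin n → ℕ) : Representation ℂ (blkSub n f (fun _ => BTy.S)) ℂ where
  toFun h := ((Perm.sign (pp (blkIncl f h)) : ℤ) : ℂ) • LinearMap.id
  map_one' := by simp; rfl
  map_mul' g h := by
    ext
    simp [mul_comm]

lemma character_sgnRep {n : ℕ} (f : Fin n → ℕ) : (sgnRep f).character = resChar _ sgnChar := by
  funext h
  obtain ⟨u, -, hu⟩ := exists_blkIncl_eq h
  have h1 : (h : PG n) = emb u := congrArg Subtype.val hu
  rw [resChar, h1, sgnChar_emb, Representation.character]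
  simp [sgnRep, hu]

lemma isAlt_sgnRep_hom {n : ℕ} {f : Fin n → ℕ} {V : Type} [AddCommGroup V] [Module ℂ V]
    {ρ : Representation ℂ (BWn n) V}
    (φ : (sgnRep f).IntertwiningMap (MonoidHom.comp ρ (blkIncl f))) : IsAlt f ρ (φ 1) :=
  fun u hu => by
    have h1 := Representation.IntertwiningMap.isIntertwining _ _ φ
      ⟨signedPerm u fun _ => false, signedPerm_false_mem f _ u hu⟩ 1
    have h2 : blkIncl f ⟨signedPerm u fun _ => false, signedPerm_false_mem f _ u hu⟩ = emb u := rfl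
    rw [MonoidHom.comp_apply, h2] at h1
    rw [← h1]
    change φ (((Perm.sign (pp (blkIncl f _)) : ℤ) : ℂ) • (1 : ℂ)) = _
    rw [h2, pp_emb, map_smul]

/-- The homomorphism from the sign representation given by an alternating vector. -/
def IsAlt.hom {n : ℕ} {f : Fin n → ℕ} {V : Type} [AddCommGroup V] [Module ℂ V]
    {ρ : Representation ℂ (BWn n) V} {v : V} (hv : IsAlt f ρ v) :
    (sgnRep f).IntertwiningMap (MonoidHom.comp ρ (blkIncl f)) :=
  LinearMap.intertwiningMap_of_isIntertwiningMap _ _ (f := LinearMap.toSpanSingleton ℂ V v)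
    fun h c => by
      obtain ⟨u, hu, hh⟩ := exists_blkIncl_eq h
      rw [MonoidHom.comp_apply, hh, LinearMap.toSpanSingleton_apply,
        LinearMap.toSpanSingleton_apply, map_smul, hv u hu]
      simp [sgnRep, hh, mul_smul, smul_comm c]

lemma IsAlt.hom_one {n : ℕ} {f : Fin n → ℕ} {V : Type} [AddCommGroup V] [Module ℂ V]
    {ρ : Representation ℂ (BWn n) V} {v : V} (hv : IsAlt f ρ v) : hv.hom 1 = v :=
  one_smul ℂ v

lemma sgnRep_hom_ext {n : ℕ} {f : Fin n → ℕ} {V : Type} [AddCommGroup V] [Module ℂ V]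
    {σ : Representation ℂ (blkSub n f (fun _ => BTy.S)) V} {φ ψ : (sgnRep f).IntertwiningMap σ}
    (h : φ 1 = ψ 1) : φ = ψ :=
  Representation.IntertwiningMap.ext (LinearMap.ext_ring h)

lemma bMult_blkSub {n : ℕ} (f : Fin n → ℕ) (d : ℕ) :
    bMult (resChar (blkSub n f (fun _ => BTy.S)) reflChar) (resChar _ sgnChar) d =
      Module.finrank ℂ ((sgnRep f).IntertwiningMap
        (MonoidHom.comp (monoRep _ (permStable_degExp n d)) (blkIncl f))) := by
  rw [bMult, ← character_sgnRep, ← cinner_character]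
  congr 1
  funext h
  rw [symChar_inclusion (blkSub_S_le f), symChar_reflChar,
    ← character_monoRep _ (permStable_degExp n d)]
  rfl

lemma bMult_blkSub_of_lt {n : ℕ} {f : Fin n → ℕ} {d : ℕ} (hd : d < ∑ i, vdmExp f i) :
    bMult (resChar (blkSub n f (fun _ => BTy.S)) reflChar) (resChar _ sgnChar) d = 0 := by
  rw [bMult_blkSub]
  have : Subsingleton ((sgnRep f).IntertwiningMap
      (MonoidHom.comp (monoRep _ (permStable_degExp n d)) (blkIncl f))) := ⟨fun φ ψ => by
    have h0 := fun φ => (isAlt_sgnRep_hom (f := f) (ρ := monoRep _ (permStable_degExp n d))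
      φ).eq_zero (fun e he => ((mem_degExp.1 he).trans_lt hd).le)
      fun h => absurd (mem_degExp.1 h) hd.ne'
    exact sgnRep_hom_ext ((h0 φ).trans (h0 ψ).symm)⟩
  rw [Module.finrank_zero_of_subsingleton, Nat.cast_zero]

lemma bMult_blkSub_eq_one {n : ℕ} (f : Fin n → ℕ) :
    bMult (resChar (blkSub n f (fun _ => BTy.S)) reflChar) (resChar _ sgnChar)
      (∑ i, vdmExp f i) = 1 := by
  have hmem : vdmExp f ∈ degExp n (∑ i, vdmExp f i) := by simp
  have h1 := vdm_vdmExp f hmem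
  rw [bMult_blkSub, Nat.cast_eq_one]
  refine (finrank_eq_one_iff_of_nonzero' (isAlt_vdm f).hom fun h => ?_).2 fun φ => ?_
  · have h2 : (isAlt_vdm f).hom 1 = 0 := by rw [h]; rfl
    rw [IsAlt.hom_one] at h2
    rw [h2] at h1
    exact zero_ne_one h1
  · refine ⟨φ 1 ⟨_, hmem⟩, sgnRep_hom_ext (sub_eq_zero.1 ?_)⟩
    have hA := isAlt_sgnRep_hom (ρ := monoRep _ (permStable_degExp n _))
      (φ 1 ⟨_, hmem⟩ • (isAlt_vdm f).hom - φ)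
    refine hA.eq_zero (fun e he => (mem_degExp.1 he).le) fun _ => ?_
    change φ 1 ⟨_, hmem⟩ * (isAlt_vdm f).hom 1 ⟨_, hmem⟩ - φ 1 ⟨_, hmem⟩ = 0
    rw [IsAlt.hom_one, h1, mul_one, sub_self]

lemma bMult_vdmRep {n : ℕ} (f : Fin n → ℕ) (d : ℕ) :
    bMult (resChar (BWn n) reflChar) (vdmRep f).character d =
      Module.finrank ℂ ((vdmRep f).IntertwiningMap (monoRep _ (permStable_degExp n d))) := by
  rw [bMult, ← cinner_character]
  congr 1
  funext w
  rw [symChar_reflChar, ← character_monoRep]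

lemma cinner_vdmRep_indChar_ne_zero {n : ℕ} (f : Fin n → ℕ) :
    cinner (vdmRep f).character
      (indChar (blkSub n f (fun _ => BTy.S)) (BWn n) (resChar _ sgnChar)) ≠ 0 := by
  rw [cinner_indChar (blkSub_S_le f) fun x g => Representation.char_conj .., cinner_comm,
    ← character_sgnRep]
  change cinner _ (Representation.character (MonoidHom.comp (vdmRep f) (blkIncl f))) ≠ 0
  rw [cinner_character, Nat.cast_ne_zero]
  intro h0
  have := Module.finrank_zero_iff.1 h0
  have h1 : (isAlt_vdmGen f).hom = 0 := Subsingleton.elim _ _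
  have h2 : (isAlt_vdmGen f).hom 1 = 0 := by rw [h1]; rfl
  rw [IsAlt.hom_one] at h2
  have h3 := vdm_vdmExp f (by simp)
  rw [show vdm f = 0 from congrArg Subtype.val h2] at h3
  exact zero_ne_one h3

/-- The truncated induction of the sign character of a product of symmetric groups is generated by
the product of Vandermonde determinants. -/
theorem isJInd_vdmRep {n : ℕ} (f : Fin n → ℕ) :
    IsJInd reflChar (blkSub n f (fun _ => BTy.S)) (BWn n) (resChar _ sgnChar)
      (vdmRep f).character := by
  refine ⟨⟨⟨_, _, _, vdmRep f, inferInstance, fun _ => rfl⟩, ?_⟩,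
    cinner_vdmRep_indChar_ne_zero f, ∑ i, vdmExp f i, ⟨?_, fun d => bMult_blkSub_of_lt⟩,
    bMult_blkSub_eq_one f, ?_, fun d hd => ?_⟩
  · rw [cinner_character, finrank_vdmRep_end, Nat.cast_one]
  · rw [bMult_blkSub_eq_one]
    exact one_ne_zero
  · rw [bMult_vdmRep, finrank_vdmRep_hom_eq_one _ subset_rfl (by simp), Nat.cast_one]
    exact one_ne_zero
  · rw [bMult_vdmRep, finrank_vdmRep_hom_eq_zero _
      (fun e he => ((mem_degExp.1 he).trans_lt hd).le)
      fun h => hd.ne' (mem_degExp.1 h), Nat.cast_zero]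

/-- A finite sequence of parts, extended by zero. -/
def extPart {σ : ℕ} (p : Fin σ → ℕ) (t : ℕ) : ℕ := if h : t < σ then p ⟨t, h⟩ else 0

lemma antitone_extPart {σ : ℕ} {p : Fin σ → ℕ} (hp : Antitone p) : Antitone (extPart p) :=
  fun a b hab => by
    unfold extPart
    split_ifs with h1 h2
    · exact hp hab
    · omega
    · exact Nat.zero_le _
    · exact le_rfl

lemma lt_card_filter_le_iff {σ : ℕ} {p : Fin σ → ℕ} (hp : Antitone p) {i : ℕ} (hi : 1 ≤ i)
    (t : ℕ) : t < (Finset.univ.filter fun t' : Fin σ => i ≤ p t').card ↔ i ≤ extPart p t := by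
  have hmem : ∀ t : Fin σ, i ≤ p t ↔ i ≤ extPart p t := fun t => by rw [extPart, dif_pos t.2]
  rw [← not_iff_not, not_lt, not_le]
  constructor
  · intro h
    by_contra! h'
    have hlt : t < σ := by
      by_contra hc
      rw [extPart, dif_neg hc] at h'
      omega
    have hs : Finset.Iic (⟨t, hlt⟩ : Fin σ) ⊆ Finset.univ.filter fun t' : Fin σ => i ≤ p t' :=
      fun t' ht' => by
        rw [Finset.mem_filter, hmem]
        exact ⟨Finset.mem_univ _, h'.trans (antitone_extPart hp (Fin.le_def.1 (Finset.mem_Iic.1 ht')))⟩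
    have := Finset.card_le_card hs
    rw [Fin.card_Iic] at this
    simp only at this
    omega
  · intro h
    rw [← Finset.card_range t, ← Finset.card_map Fin.valEmbedding]
    refine Finset.card_le_card fun x hx => ?_
    obtain ⟨t', ht', rfl⟩ := Finset.mem_map.1 hx
    rw [Finset.mem_filter, hmem] at ht'
    rw [Finset.mem_range]
    by_contra! hle
    have := antitone_extPart hp hle
    simp only [Fin.valEmbedding_apply] at this
    omega

lemma sum_range_reflect_succ {M : Type*} [AddCommMonoid M] (F : ℕ → M) (k : ℕ) :
    ∑ b ∈ Finset.range k, F (k - b) = ∑ b ∈ Finset.range k, F (b + 1) := by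
  rw [← Finset.sum_range_reflect]
  refine Finset.sum_congr rfl fun b hb => ?_
  rw [Finset.mem_range] at hb
  congr 1
  omega

lemma sum_if_succ_le {k m : ℕ} (h : m ≤ k) :
    ∑ b ∈ Finset.range k, (if b + 1 ≤ m then 1 else 0) = m := by
  rw [← Finset.card_filter]
  conv_rhs => rw [← Finset.card_range m]
  congr 1
  ext b
  simp only [Finset.mem_filter, Finset.mem_range]
  omega

lemma content_vdmExp_blockOf {σ n k : ℕ} {p : Fin σ → ℕ} (hp : Antitone p)
    (hk : ∀ t, p t ≤ k) (hsum : ∑ t, p t = n) {pbar : ℕ → ℕ}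
    (hpbar : ∀ i, pbar i = (Finset.univ.filter fun t : Fin σ => i ≤ p t).card) :
    content (vdmExp fun i : Fin n => blockOf k (fun b => pbar (k - b)) (i : ℕ)) = extPart p := by
  have hn : ∑ b ∈ Finset.range k, pbar (k - b) = n := by
    rw [sum_range_reflect_succ pbar, ← hsum]
    simp only [hpbar, Finset.card_filter]
    rw [Finset.sum_comm]
    exact Finset.sum_congr rfl fun t _ => sum_if_succ_le (hk t)
  funext t
  rw [content_vdmExp (S := Finset.range k)
    (fun i => Finset.mem_range.2 (blockOf_lt (hn.symm ▸ i.2))), Finset.card_filter]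
  rw [Finset.sum_congr rfl fun b hb =>
    show _ = if k - b ≤ extPart p t then 1 else 0 from ?_]
  · rw [sum_range_reflect_succ fun b => if b ≤ extPart p t then 1 else 0, sum_if_succ_le]
    unfold extPart
    split_ifs
    exacts [hk _, Nat.zero_le _]
  · have hb' := Finset.mem_range.1 hb
    rw [content_blockOf hn hb', hpbar]
    simp only [lt_card_filter_le_iff hp (show 1 ≤ k - b by omega)]

lemma exists_expo_eq {τ t : ℕ} (ht : t < 2 * τ + 1) :
    ∃ x : Fin (τ + 1) ⊕ Fin τ, expo x = t := by
  rcases Nat.even_or_odd' t with ⟨a, rfl | rfl⟩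
  · exact ⟨Sum.inl ⟨a, by omega⟩, rfl⟩
  · exact ⟨Sum.inr ⟨a, by omega⟩, rfl⟩

lemma injective_add_rev {r : ℕ} {a : Fin r → ℕ} (ha : Antitone a) :
    Function.Injective fun i => a i + (i.rev : ℕ) := by
  refine StrictAnti.injective fun i j hij => ?_
  have h1 := ha hij.le
  have h2 := Fin.rev_lt_rev.2 hij
  exact add_lt_add_of_le_of_lt h1 h2

/-- The truncated induction of the sign character of a product of symmetric groups, with a common
description of the symbol for both parities of the number of parts. -/
theorem isJInd_chiBSymbol {σ τ n k : ℕ} (hστ : σ ≤ 2 * τ + 1) {p : Fin σ → ℕ} (hp : Antitone p)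
    (hk : ∀ t, p t ≤ k) (hsum : ∑ t, p t = n) {pbar : ℕ → ℕ}
    (hpbar : ∀ i, pbar i = (Finset.univ.filter fun t : Fin σ => i ≤ p t).card)
    {row1 : Fin (τ + 1) → ℕ} {row2 : Fin τ → ℕ}
    (h1 : ∀ u : Fin (τ + 1), row1 u = extPart p (2 * (τ - u)) + u)
    (h2 : ∀ u : Fin τ, row2 u = extPart p (2 * (τ - 1 - u) + 1) + u) :
    IsJInd reflChar (blkSub n (fun i => blockOf k (fun b => pbar (k - b)) (i : ℕ)) fun _ => BTy.S)
      (BWn n) (resChar _ sgnChar) (chiBSymbol n τ row1 row2) := by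
  have hc := content_vdmExp_blockOf hp hk hsum hpbar
  set f : Fin n → ℕ := fun i => blockOf k (fun b => pbar (k - b)) (i : ℕ)
  have hlt : ∀ i, vdmExp f i < 2 * τ + 1 := fun i => by
    by_contra! h
    have h0 : content (vdmExp f) (vdmExp f i) = 0 := by
      rw [hc, extPart, dif_neg (by omega)]
    exact Finset.notMem_empty i (Finset.card_eq_zero.1 h0 ▸ by simp)
  choose g hg using fun i => exists_expo_eq (hlt i)
  have hg' : vdmExp f = expo ∘ g := funext fun i => (hg i).symm
  have hcg : ∀ x, content g x = extPart p (expo x) := fun x => by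
    rw [← hc, hg', content, content]
    simp only [Function.comp_apply, expo_injective.eq_iff]
  have hX : chiBSymbol n τ row1 row2 = (vdmRep f).character := by
    rw [← chiB_eq_character hg', chiBSymbol]
    · congr 1 <;> funext i <;> rw [hcg]
      · rw [h1, expo, Sum.elim_inl]
        simp only
        rw [show τ - (τ - (i : ℕ)) = i by omega]
        push_cast
        ring
      · rw [h2, expo, Sum.elim_inr]
        simp only
        rw [show τ - 1 - (τ - 1 - (i : ℕ)) = i by omega]
        push_cast
        ring
    · refine injective_add_rev fun i j hij => ?_
      rw [hcg, hcg]
      exact antitone_extPart hp (Nat.mul_le_mul_left 2 hij)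
    · refine injective_add_rev fun i j hij => ?_
      rw [hcg, hcg]
      exact antitone_extPart hp (Nat.add_le_add_right (Nat.mul_le_mul_left 2 hij) 1)
  rw [hX]
  exact isJInd_vdmRep f

/-- 3.2(g): for a partition `p₁ ≥ … ≥ p_σ ≥ 1` of `n` with
conjugate partition `p̄` and `k = p₁`, the `j`-induction
`j_{S_{p̄ₖ} × … × S_{p̄₂} × S_{p̄₁}}^{W_n}(sgn)` equals the irreducible representation
of `W_n` with symbol
`[(p_σ < p_{σ-2}+1 < … < p₁+τ), (p_{σ-1} < p_{σ-3}+1 < … < p₂+τ-1)]` if `σ = 2τ+1`,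
and `[(0 < p_{σ-1}+1 < … < p₁+τ), (p_σ < p_{σ-2}+1 < … < p₂+τ-1)]` if `σ = 2τ`.
(Here `p` is 0-indexed: the paper's `pₜ` is `p (t-1)`.) -/
theorem stmt13 (σ τ n kk : ℕ) (hσ : 0 < σ) (p : Fin σ → ℕ)
    (hmono : Antitone p) (hp1 : ∀ t, 1 ≤ p t) (hsum : ∑ t, p t = n)
    (hkk : kk = p ⟨0, hσ⟩)
    (pbar : ℕ → ℕ)
    (hpbar : ∀ i, pbar i = (Finset.univ.filter (fun t : Fin σ => i ≤ p t)).card) :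
    (σ = 2 * τ + 1 →
      IsJInd (reflChar (n := n))
        (blkSub n (fun i => blockOf kk (fun b => pbar (kk - b)) (i : ℕ))
          (fun _ => BTy.S))
        (BWn n) (resChar _ sgnChar)
        (chiBSymbol n τ
          (fun u => p ⟨σ - 1 - 2 * (u : ℕ), by omega⟩ + (u : ℕ))
          (fun u => p ⟨σ - 2 - 2 * (u : ℕ), by omega⟩ + (u : ℕ)))) ∧
    (σ = 2 * τ →
      IsJInd (reflChar (n := n))
        (blkSub n (fun i => blockOf kk (fun b => pbar (kk - b)) (i : ℕ))
          (fun _ => BTy.S))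
        (BWn n) (resChar _ sgnChar)
        (chiBSymbol n τ
          (fun u => if h : (u : ℕ) = 0 then 0
            else p ⟨σ - 2 * (u : ℕ), by omega⟩ + (u : ℕ))
          (fun u => p ⟨σ - 1 - 2 * (u : ℕ), by omega⟩ + (u : ℕ)))) := by
  have hk : ∀ t, p t ≤ kk := fun t => hkk ▸ hmono (Nat.zero_le t)
  refine ⟨fun h => ?_, fun h => ?_⟩
  · refine isJInd_chiBSymbol (by omega) hmono hk hsum hpbar (fun u => ?_) fun u => ?_
    all_goals
      rw [extPart, dif_pos (by omega)]
      congr 3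
      omega
  · refine isJInd_chiBSymbol (by omega) hmono hk hsum hpbar (fun u => ?_) fun u => ?_
    · split_ifs with hu
      · rw [extPart, dif_neg (by omega), hu]
      · rw [extPart, dif_pos (by omega)]
        congr 3
        omega
    · rw [extPart, dif_pos (by omega)]
      congr 3
      omega

end
end CS
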